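/- For every real number x ≥ 2, the interval (x, x + 11·x^{1/5}·log x] contains a squarefree integer, i.e., there exists a positive integer n with x < n ≤ x + 11·x^{1/5}·log x such that n is squarefree. -/

import Mathlib

open Finset

namespace SFI

/-- integers in a real interval -/
lemma card_int_le (T : Finset ℤ) (lo hi : ℝ) (h : ∀ u ∈ T, lo ≤ u ∧ (u:ℝ) ≤ hi) (hlh : lo ≤ hi) :
    (T.card : ℝ) ≤ hi - lo + 1 := by
  have hsub : T ⊆ Finset.Icc ⌈lo⌉ ⌊hi⌋ := by
    intro u hu
    rw [Finset.mem_Icc]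
    exact ⟨Int.ceil_le.2 (h u hu).1, Int.le_floor.2 (h u hu).2⟩
  have h1 := Finset.card_le_card hsub
  rw [Int.card_Icc] at h1
  have h2 : (T.card : ℝ) ≤ ((⌊hi⌋ + 1 - ⌈lo⌉).toNat : ℝ) := by exact_mod_cast h1
  have h3 : (((⌊hi⌋ + 1 - ⌈lo⌉).toNat : ℤ) : ℝ) = max ((⌊hi⌋:ℝ) + 1 - ⌈lo⌉) 0 := by
    rw [Int.toNat_eq_max]; push_cast; rfl
  have h4 : ((⌊hi⌋ + 1 - ⌈lo⌉).toNat : ℝ) = max ((⌊hi⌋:ℝ) + 1 - ⌈lo⌉) 0 := by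
    rw [← h3]; norm_cast
  rw [h4] at h2
  refine h2.trans (max_le ?_ (by linarith))
  linarith [Int.floor_le hi, Int.le_ceil lo]

lemma card_sep (n : ℕ) : ∀ (T : Finset ℕ), T.card = n → ∀ (lo hi s : ℝ), 0 < s → lo ≤ hi →
    (∀ u ∈ T, lo ≤ u ∧ (u:ℝ) ≤ hi) →
    (∀ u ∈ T, ∀ w ∈ T, u < w → s ≤ (w:ℝ) - u) →
    (T.card : ℝ) ≤ (hi - lo) / s + 1 := by
  induction n with
  | zero =>
    intro T hT lo hi s hs hlh _ _
    rw [hT]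
    have : 0 ≤ (hi - lo) / s := div_nonneg (by linarith) hs.le
    push_cast; linarith
  | succ n ih =>
    intro T hT lo hi s hs hlh hb hsep
    have hne : T.Nonempty := by rw [← Finset.card_pos]; omega
    set m := T.min' hne with hm
    have hmT : m ∈ T := T.min'_mem hne
    have hcard : (T.erase m).card = n := by rw [Finset.card_erase_of_mem hmT]; omega
    by_cases hn : n = 0
    · rw [hT, hn]
      have : 0 ≤ (hi - lo) / s := div_nonneg (by linarith) hs.le
      push_cast; linarith
    · have hlt : ∀ u ∈ T.erase m, lo + s ≤ u := by
        intro u hu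
        have hu' := Finset.mem_erase.1 hu
        have : m < u := lt_of_le_of_ne (T.min'_le u hu'.2) (Ne.symm hu'.1)
        have := hsep m hmT u hu'.2 this
        linarith [(hb m hmT).1]
      have hne2 : (T.erase m).Nonempty := by rw [← Finset.card_pos]; omega
      obtain ⟨v, hv⟩ := hne2
      have := ih (T.erase m) hcard (lo + s) hi s hs
        (by linarith [hlt v hv, (hb v (Finset.mem_of_mem_erase hv)).2])
        (fun u hu => ⟨hlt u hu, (hb u (Finset.mem_of_mem_erase hu)).2⟩)
        (fun u hu w hw h => hsep u (Finset.mem_of_mem_erase hu) w (Finset.mem_of_mem_erase hw) h)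
      rw [hT]
      rw [hcard] at this
      have e : (hi - (lo + s)) / s = (hi - lo) / s - 1 := by field_simp; ring
      rw [e] at this
      push_cast; linarith

/-- every other element -/
lemma exists_half (n : ℕ) : ∀ (T : Finset ℕ), T.card ≤ n →
    ∃ T' ⊆ T, T.card ≤ 2 * T'.card ∧
      ∀ u ∈ T', ∀ w ∈ T', u < w → ∃ v ∈ T, u < v ∧ v < w := by
  induction n using Nat.strong_induction_on with
  | _ n ih =>
    intro T hT
    by_cases h2 : T.card ≤ 2
    · by_cases h0 : T.card = 0
      · exact ⟨∅, by simp, by omega, by simp⟩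
      · obtain ⟨u, hu⟩ := Finset.card_pos.1 (Nat.pos_of_ne_zero h0)
        refine ⟨{u}, by simpa using hu, by simpa using h2, ?_⟩
        intro a ha b hb hab
        simp at ha hb
        omega
    · push Not at h2
      have hne : T.Nonempty := by rw [← Finset.card_pos]; omega
      set m := T.min' hne with hm
      have hmT : m ∈ T := T.min'_mem hne
      have hc1 : (T.erase m).card = T.card - 1 := Finset.card_erase_of_mem hmT
      have hne1 : (T.erase m).Nonempty := by rw [← Finset.card_pos]; omega
      set k := (T.erase m).min' hne1 with hk
      have hkT : k ∈ T.erase m := Finset.min'_mem _ hne1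
      have hc2 : ((T.erase m).erase k).card = T.card - 2 := by
        rw [Finset.card_erase_of_mem hkT]; omega
      obtain ⟨T', hT's, hT'c, hT'⟩ := ih (n - 2) (by omega) ((T.erase m).erase k) (by omega)
      have hmk : m < k := lt_of_le_of_ne (T.min'_le k (Finset.mem_of_mem_erase hkT))
        (Ne.symm (Finset.ne_of_mem_erase hkT))
      have hgt : ∀ u ∈ T', k < u := by
        intro u hu
        have h1 := hT's hu
        exact lt_of_le_of_ne ((T.erase m).min'_le u (Finset.mem_of_mem_erase h1))
          (Ne.symm (Finset.ne_of_mem_erase h1))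
      have hmT' : m ∉ T' := fun h => by have := hgt m h; omega
      refine ⟨insert m T', ?_, ?_, ?_⟩
      · intro u hu
        rcases Finset.mem_insert.1 hu with rfl | hu
        · exact hmT
        · exact Finset.mem_of_mem_erase (Finset.mem_of_mem_erase (hT's hu))
      · rw [Finset.card_insert_of_notMem hmT']; omega
      · intro u hu w hw huw
        rcases Finset.mem_insert.1 hu with hu1 | hu1
        · rcases Finset.mem_insert.1 hw with hw1 | hw1
          · omega
          · exact ⟨k, Finset.mem_of_mem_erase hkT, by omega, hgt w hw1⟩
        · rcases Finset.mem_insert.1 hw with hw1 | hw1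
          · have := hgt u hu1; omega
          · obtain ⟨v, hv, h1, h2⟩ := hT' u hu1 w hw1 huw
            exact ⟨v, Finset.mem_of_mem_erase (Finset.mem_of_mem_erase hv), h1, h2⟩

lemma card_three (T : Finset ℕ) (lo hi s : ℝ) (hs : 0 < s) (hlh : lo ≤ hi)
    (hb : ∀ u ∈ T, lo ≤ u ∧ (u:ℝ) ≤ hi)
    (hsep : ∀ u ∈ T, ∀ v ∈ T, ∀ w ∈ T, u < v → v < w → s ≤ (w:ℝ) - u) :
    (T.card : ℝ) ≤ 2 * ((hi - lo) / s) + 2 := by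
  obtain ⟨T', hs', hc, h⟩ := exists_half T.card T le_rfl
  have := card_sep _ T' rfl lo hi s hs hlh (fun u hu => hb u (hs' hu)) (by
    intro u hu w hw huw
    obtain ⟨v, hv, h1, h2⟩ := h u hu w hw huw
    exact hsep u (hs' hu) v hv w (hs' hw) h1 h2)
  have h3 : (T.card : ℝ) ≤ 2 * T'.card := by exact_mod_cast hc
  linarith

/-- pairs lemma: elements with a close successor -/
lemma card_gap (T : Finset ℕ) (lo hi A : ℝ) (hA : 0 < A) (hlh : lo ≤ hi)
    (hb : ∀ u ∈ T, lo ≤ u ∧ (u:ℝ) ≤ hi) (I : Finset ℕ)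
    (hI : ∀ u ∈ T, ∀ w ∈ T, u < w → (w:ℝ) - u ≤ A → w - u ∈ I) :
    (T.card : ℝ) ≤ (hi - lo) / A + 1 + ∑ a ∈ I, ((T.filter (fun u => u + a ∈ T)).card : ℝ) := by
  classical
  set G := I.biUnion (fun a => T.filter (fun u => u + a ∈ T)) with hG
  have h1 : T.card ≤ (T \ G).card + G.card := by
    have := Finset.card_le_card_sdiff_add_card (s := T) (t := G)
    simpa using this
  have h2 : G.card ≤ ∑ a ∈ I, (T.filter (fun u => u + a ∈ T)).card := Finset.card_biUnion_le
  have h3 := card_sep _ (T \ G) rfl lo hi A hA hlh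
    (fun u hu => hb u (Finset.mem_sdiff.1 hu).1) (by
      intro u hu w hw huw
      by_contra hlt
      push Not at hlt
      have hu' := Finset.mem_sdiff.1 hu
      have hw' := Finset.mem_sdiff.1 hw
      apply hu'.2
      rw [hG, Finset.mem_biUnion]
      refine ⟨w - u, hI u hu'.1 w hw'.1 huw hlt.le, ?_⟩
      rw [Finset.mem_filter]
      refine ⟨hu'.1, ?_⟩
      rw [Nat.add_sub_cancel' huw.le]; exact hw'.1)
  have h4 : (T.card : ℝ) ≤ (T \ G).card + G.card := by exact_mod_cast h1
  have h5 : (G.card : ℝ) ≤ ∑ a ∈ I, ((T.filter (fun u => u + a ∈ T)).card : ℝ) := by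
    exact_mod_cast h2
  linarith

lemma card_fibre {α : Type*} (T : Finset α) (f : α → ℤ) (lo hi C : ℝ) (hlh : lo ≤ hi) (hC : 0 ≤ C)
    (hf : ∀ u ∈ T, lo ≤ f u ∧ (f u : ℝ) ≤ hi)
    (hfib : ∀ N : ℤ, ((T.filter (fun u => f u = N)).card : ℝ) ≤ C) :
    (T.card : ℝ) ≤ C * (hi - lo + 1) := by
  classical
  have h1 := Finset.card_eq_sum_card_image f T
  have h2 : (T.card : ℝ) = ∑ b ∈ T.image f, ((T.filter (fun u => f u = b)).card : ℝ) := by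
    exact_mod_cast h1
  rw [h2]
  have h3 := card_int_le (T.image f) lo hi (by
    intro u hu
    obtain ⟨v, hv, rfl⟩ := Finset.mem_image.1 hu
    exact hf v hv) hlh
  calc _ ≤ ∑ b ∈ T.image f, C := Finset.sum_le_sum (fun b _ => hfib b)
    _ = (T.image f).card * C := by rw [Finset.sum_const, nsmul_eq_mul]
    _ ≤ (hi - lo + 1) * C := by gcongr
    _ = _ := by ring

/-- sum of inverse cubes over even numbers -/
lemma sum_inv_cube (s : ℕ) (hs : 2 ≤ s) (n : ℕ) :
    ∑ k ∈ Finset.range n, 1 / (((s + 2 * k : ℕ) : ℝ)) ^ 3 ≤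
      1 / (4 * ((s:ℝ) - 1) ^ 2) - 1 / (4 * ((s:ℝ) + 2 * n - 1) ^ 2) := by
  have hs' : (2:ℝ) ≤ s := by exact_mod_cast hs
  induction n with
  | zero => simp
  | succ n ih =>
    rw [Finset.sum_range_succ]
    push_cast at ih ⊢
    set y : ℝ := s + 2 * n with hy
    have hy2 : 2 ≤ y := by have : (0:ℝ) ≤ n := by positivity
                           linarith
    have key : 1 / y ^ 3 ≤ 1 / (4 * (y - 1) ^ 2) - 1 / (4 * (y + 1) ^ 2) := by
      have h1 : 0 < y - 1 := by linarith
      have : 1 / (4 * (y - 1) ^ 2) - 1 / (4 * (y + 1) ^ 2) = y / ((y-1)^2 * (y+1)^2) := by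
        field_simp; ring
      rw [this, div_le_div_iff₀ (by positivity) (by positivity)]
      nlinarith [mul_self_nonneg (y*y), sq_nonneg y]
    have e : (s:ℝ) + 2 * (n + 1) - 1 = y + 1 := by rw [hy]; ring
    rw [e]
    linarith

lemma sum_inv_cube_I (I : Finset ℕ) (s0 : ℝ) (hs0 : 1 < s0) (hI : ∀ a ∈ I, Even a ∧ s0 ≤ a) :
    ∑ a ∈ I, 1 / (a:ℝ) ^ 3 ≤ 1 / (4 * (s0 - 1) ^ 2) := by
  classical
  rcases I.eq_empty_or_nonempty with rfl | hne
  · simp; positivity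
  set s := I.min' hne with hs
  have hsI : s ∈ I := I.min'_mem hne
  have hss := hI s hsI
  have hs2 : 2 ≤ s := by
    have h1 : (1:ℝ) < s := lt_of_lt_of_le hs0 hss.2
    have : 1 < s := by exact_mod_cast h1
    exact this
  have hsub : I ⊆ (Finset.range (I.max' hne + 1)).image (fun k => s + 2 * k) := by
    intro a ha
    have h1 := I.min'_le a ha
    have h2 := I.le_max' a ha
    obtain ⟨b, hb⟩ := (hI a ha).1
    obtain ⟨c, hc⟩ := hss.1
    rw [Finset.mem_image]
    refine ⟨b - c, ?_, ?_⟩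
    · rw [Finset.mem_range]; omega
    · omega
  calc ∑ a ∈ I, 1 / (a:ℝ) ^ 3 ≤ ∑ a ∈ (Finset.range (I.max' hne + 1)).image (fun k => s + 2 * k), 1 / (a:ℝ)^3 :=
        Finset.sum_le_sum_of_subset_of_nonneg hsub (fun _ _ _ => by positivity)
    _ = ∑ k ∈ Finset.range (I.max' hne + 1), 1 / (((s + 2 * k : ℕ) : ℝ)) ^ 3 := by
        rw [Finset.sum_image]; intro a _ b _ h; simpa using h
    _ ≤ 1 / (4 * ((s:ℝ) - 1) ^ 2) - 1 / (4 * ((s:ℝ) + 2 * ((I.max' hne + 1 : ℕ):ℝ) - 1) ^ 2) := sum_inv_cube s hs2 _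
    _ ≤ 1 / (4 * ((s:ℝ) - 1) ^ 2) := by
        have : (0:ℝ) ≤ 1 / (4 * ((s:ℝ) + 2 * ((I.max' hne + 1 : ℕ):ℝ) - 1) ^ 2) := by positivity
        linarith
    _ ≤ _ := by
        have : 0 < s0 - 1 := by linarith
        gcongr
        exact hss.2

end SFI

namespace SFI
open Finset

/-- `u` has a multiple of `u^2` in `(x, x+h]` -/
def Good (x h : ℝ) (u : ℕ) : Prop := ∃ m : ℕ, x < (m:ℝ) * (u:ℝ)^2 ∧ (m:ℝ) * (u:ℝ)^2 ≤ x + h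

noncomputable def mu (x : ℝ) (u : ℕ) : ℤ := ⌊x / (u:ℝ)^2⌋ + 1

lemma mu_spec {x h : ℝ} {u : ℕ} (hu : 0 < u) (hg : Good x h u) :
    ∃ e : ℝ, (mu x u : ℝ) = x / (u:ℝ)^2 + e ∧ 0 < e ∧ e ≤ h / (u:ℝ)^2 := by
  obtain ⟨m, h1, h2⟩ := hg
  have hu2 : (0:ℝ) < (u:ℝ)^2 := by positivity
  have h3 : x / (u:ℝ)^2 < m := by rwa [div_lt_iff₀ hu2]
  have h4 : (m:ℝ) ≤ x / (u:ℝ)^2 + h / (u:ℝ)^2 := by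
    rw [← add_div, le_div_iff₀ hu2]; exact h2
  have h5 : ⌊x / (u:ℝ)^2⌋ < (m:ℤ) := by
    rw [Int.floor_lt]; exact_mod_cast h3
  have h6 : mu x u ≤ (m:ℤ) := by unfold mu; omega
  have h7 : (mu x u : ℝ) ≤ m := by exact_mod_cast h6
  have h8 : x / (u:ℝ)^2 < mu x u := by
    unfold mu; push_cast; exact Int.lt_floor_add_one _
  exact ⟨mu x u - x / (u:ℝ)^2, by ring, by linarith, by linarith⟩

lemma mu_spec_M {x h M : ℝ} {u : ℕ} (hM : 0 < M) (hu : M ≤ u) (hh : 0 ≤ h) (hg : Good x h u) :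
    ∃ e : ℝ, (mu x u : ℝ) = x / (u:ℝ)^2 + e ∧ 0 < e ∧ e ≤ h / M^2 := by
  have hu0 : 0 < u := by exact_mod_cast lt_of_lt_of_le hM hu
  obtain ⟨e, h1, h2, h3⟩ := mu_spec hu0 hg
  refine ⟨e, h1, h2, h3.trans ?_⟩
  gcongr

lemma three_id (u a b : ℝ) (hu : 0 < u) (ha : 0 < a) (hb : 0 < b) :
    b / u^2 - (a+b) / (u+a)^2 + a / (u+a+b)^2 =
      a * b * (a+b) * (1/(u*(u+a)*(u+a+b)*(u+a+b)) + 1/(u*u*(u+a)*(u+a+b))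
        + 1/(u*(u+a)*(u+a)*(u+a+b))) := by
  have h1 : u + a ≠ 0 := by positivity
  have h2 : u + a + b ≠ 0 := by positivity
  field_simp
  ring

lemma ab_le (a b : ℝ) : a * b ≤ (a+b)^2/4 := by nlinarith [sq_nonneg (a-b)]

lemma inv4_bounds (p q r s lo hi : ℝ) (hlo : 0 < lo) (hp : lo ≤ p) (hp2 : p ≤ hi)
    (hq : lo ≤ q) (hq2 : q ≤ hi) (hr : lo ≤ r) (hr2 : r ≤ hi) (hs : lo ≤ s) (hs2 : s ≤ hi) :
    1 / hi^4 ≤ 1 / (p*q*r*s) ∧ 1/(p*q*r*s) ≤ 1/lo^4 := by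
  have hp0 := hlo.trans_le hp
  have hq0 := hlo.trans_le hq
  have hr0 := hlo.trans_le hr
  have hs0 := hlo.trans_le hs
  have hi0 : 0 < hi := by linarith
  constructor
  · apply one_div_le_one_div_of_le (by positivity)
    calc p*q*r*s ≤ hi*hi*hi*hi := by gcongr
      _ = hi^4 := by ring
  · apply one_div_le_one_div_of_le (by positivity)
    calc lo^4 = lo*lo*lo*lo := by ring
      _ ≤ p*q*r*s := by gcongr

lemma inv4_diff (p q r s lo hi a : ℝ) (hlo : 0 < lo) (ha : 0 < a) (hp : lo ≤ p) (hp2 : p + a ≤ hi)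
    (hq : lo ≤ q) (hq2 : q + a ≤ hi) (hr : lo ≤ r) (hr2 : r + a ≤ hi)
    (hs : lo ≤ s) (hs2 : s + a ≤ hi) :
    4 * a / hi^5 ≤ 1 / (p*q*r*s) - 1 / ((p+a)*(q+a)*(r+a)*(s+a)) ∧
    1 / (p*q*r*s) - 1 / ((p+a)*(q+a)*(r+a)*(s+a)) ≤ 4 * a / lo^5 := by
  have hp0 := hlo.trans_le hp
  have hq0 := hlo.trans_le hq
  have hr0 := hlo.trans_le hr
  have hs0 := hlo.trans_le hs
  have hid : 1 / (p*q*r*s) - 1 / ((p+a)*(q+a)*(r+a)*(s+a)) =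
      a * (1/(p*q*r*s) * (1/(s+a)) + 1/(p*q*r*(s+a)) * (1/(r+a)) +
        1/(p*q*(r+a)*(s+a)) * (1/(q+a)) + 1/(p*(q+a)*(r+a)*(s+a)) * (1/(p+a))) := by
    field_simp
    ring
  have hi0 : 0 < hi := by linarith
  obtain ⟨a1, b1⟩ := inv4_bounds p q r s lo hi hlo hp (by linarith) hq (by linarith) hr (by linarith) hs (by linarith)
  obtain ⟨a2, b2⟩ := inv4_bounds p q r (s+a) lo hi hlo hp (by linarith) hq (by linarith) hr (by linarith) (by linarith) hs2
  obtain ⟨a3, b3⟩ := inv4_bounds p q (r+a) (s+a) lo hi hlo hp (by linarith) hq (by linarith) (by linarith) hr2 (by linarith) hs2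
  obtain ⟨a4, b4⟩ := inv4_bounds p (q+a) (r+a) (s+a) lo hi hlo hp (by linarith) (by linarith) hq2 (by linarith) hr2 (by linarith) hs2
  have key : ∀ y, lo ≤ y → y + a ≤ hi → 1 / hi ≤ 1/(y+a) ∧ 1/(y+a) ≤ 1/lo := fun y h1 h2 =>
    ⟨one_div_le_one_div_of_le (by linarith) h2, one_div_le_one_div_of_le hlo (by linarith)⟩
  obtain ⟨c1, d1⟩ := key s hs hs2
  obtain ⟨c2, d2⟩ := key r hr hr2
  obtain ⟨c3, d3⟩ := key q hq hq2
  obtain ⟨c4, d4⟩ := key p hp hp2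
  rw [hid]
  constructor
  · calc 4 * a / hi^5 = a * (1/hi^4*(1/hi) + 1/hi^4*(1/hi) + 1/hi^4*(1/hi) + 1/hi^4*(1/hi)) := by
          field_simp; ring
      _ ≤ _ := by gcongr
  · calc _ ≤ a * (1/lo^4*(1/lo) + 1/lo^4*(1/lo) + 1/lo^4*(1/lo) + 1/lo^4*(1/lo)) := by gcongr
      _ = 4 * a / lo^5 := by field_simp; ring

set_option maxHeartbeats 1000000 in
/-- three point lemma, general form -/
lemma three_pt (x h M lam g : ℝ) (hx : 0 < x) (hh : 0 ≤ h) (hM : 0 < M) (hlam : 1 ≤ lam) (hg : 0 < g)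
    (hcond : h * lam^4 * M^2 < 3 * g^2 * x)
    (u v w : ℕ) (hu : M ≤ u) (hw : (w:ℝ) ≤ lam * M) (huv : u < v) (hvw : v < w)
    (ou : Odd u) (ov : Odd v) (ow : Odd w)
    (gu : Good x h u) (gv : Good x h v) (gw : Good x h w)
    (hg1 : g ≤ (v:ℝ) - u) (hg2 : g ≤ (w:ℝ) - v) :
    2 ≤ 3/4 * ((w:ℝ)-u)^3 * x / M^4 + ((w:ℝ)-u) * h / M^2 := by
  have huv' : (u:ℝ) < v := by exact_mod_cast huv
  have hvw' : (v:ℝ) < w := by exact_mod_cast hvw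
  obtain ⟨e1, hm1, he1, he1'⟩ := mu_spec_M hM hu hh gu
  obtain ⟨e2, hm2, he2, he2'⟩ := mu_spec_M hM (by linarith) hh gv
  obtain ⟨e3, hm3, he3, he3'⟩ := mu_spec_M hM (by linarith) hh gw
  set a : ℝ := (v:ℝ) - u with ha
  set b : ℝ := (w:ℝ) - v with hb
  set E := h / M^2 with hE
  have hu0 : (0:ℝ) < u := by linarith
  have ha0 : 0 < a := by linarith
  have hb0 : 0 < b := by linarith
  set I : ℤ := ((w:ℤ)-v) * mu x u - ((w:ℤ)-u) * mu x v + ((v:ℤ)-u) * mu x w with hI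
  have hIeven : Even I := by
    have e1 : Even ((w:ℤ)-v) := by
      apply Odd.sub_odd <;> exact_mod_cast (by assumption)
    have e2 : Even ((w:ℤ)-u) := by
      apply Odd.sub_odd <;> exact_mod_cast (by assumption)
    have e3 : Even ((v:ℤ)-u) := by
      apply Odd.sub_odd <;> exact_mod_cast (by assumption)
    exact ((e1.mul_right _).sub (e2.mul_right _)).add (e3.mul_right _)
  have hid := three_id u a b hu0 ha0 hb0
  have hv' : (u:ℝ) + a = v := by rw [ha]; ring
  have hw' : (v:ℝ) + b = w := by rw [hb]; ring
  rw [hv', hw'] at hid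
  have hIr : (I:ℝ) = x * (a * b * (a+b) * (1/(u*v*w*w) + 1/(u*u*v*w) + 1/((u:ℝ)*v*v*w)))
      + (b * e1 - (a+b) * e2 + a * e3) := by
    rw [← hid, hI]; push_cast; rw [hm1, hm2, hm3]
    have : (w:ℝ) - u = a + b := by rw [ha, hb]; ring
    rw [this, ← hb, ← ha]; ring
  have hws : (w:ℝ) - u = a + b := by rw [ha, hb]; ring
  obtain ⟨p1, q1⟩ := inv4_bounds u v w w M (lam*M) hM hu (by linarith) (by linarith) (by linarith) (by linarith) hw (by linarith) hw
  obtain ⟨p2, q2⟩ := inv4_bounds u u v w M (lam*M) hM hu (by linarith) hu (by linarith) (by linarith) (by linarith) (by linarith) hw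
  obtain ⟨p3, q3⟩ := inv4_bounds u v v w M (lam*M) hM hu (by linarith) (by linarith) (by linarith) (by linarith) (by linarith) (by linarith) hw
  set Z := 1/((u:ℝ)*v*w*w) + 1/((u:ℝ)*u*v*w) + 1/((u:ℝ)*v*v*w) with hZ
  have hZlo : 3 * (1/(lam*M)^4) ≤ Z := by linarith
  have hZhi : Z ≤ 3 * (1/M^4) := by linarith
  have hE0 : 0 ≤ E := by positivity
  have herr1 : b * e1 - (a+b) * e2 + a * e3 ≤ (a+b) * E := by
    have k1 : b * e1 ≤ b * E := by gcongr
    have k2 : a * e3 ≤ a * E := by gcongr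
    have k3 := mul_pos (add_pos ha0 hb0) he2
    linarith
  have herr2 : -((a+b) * E) ≤ b * e1 - (a+b) * e2 + a * e3 := by
    have k1 := mul_pos hb0 he1
    have k2 := mul_pos ha0 he3
    have k3 : (a+b) * e2 ≤ (a+b) * E := by gcongr
    linarith
  have hIpos : 0 < I := by
    have : (0:ℝ) < I := by
      rw [hIr]
      have hk : E < 3 * g^2 * x * (1/(lam*M)^4) := by
        rw [hE, mul_one_div, div_lt_div_iff₀ (by positivity) (by positivity)]
        have : h * (lam*M)^4 = (h * lam^4 * M^2) * M^2 := by ring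
        rw [this]
        exact mul_lt_mul_of_pos_right hcond (by positivity)
      have hab : g^2 ≤ a * b := by rw [sq]; exact mul_le_mul hg1 hg2 hg.le ha0.le
      have h1 : 3 * g^2 * x * (1/(lam*M)^4) ≤ x * (a * b * Z) := by
        have : 0 ≤ 1/(lam*M)^4 := by positivity
        calc 3 * g^2 * x * (1/(lam*M)^4) = x * (g^2 * (3 * (1/(lam*M)^4))) := by ring
          _ ≤ _ := by gcongr
      have h2 : (a+b) * E < (a+b) * (x * (a*b*Z)) := by
        apply mul_lt_mul_of_pos_left _ (by linarith); linarith
      have h3 : x * (a * b * (a+b) * Z) = (a+b) * (x * (a*b*Z)) := by ring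
      rw [h3]; linarith
    exact_mod_cast this
  have hI2 : 2 ≤ I := by
    obtain ⟨k, hk⟩ := hIeven; omega
  have hI2' : (2:ℝ) ≤ I := by exact_mod_cast hI2
  rw [hws]
  have h4ab : a * b ≤ (a+b)^2/4 := ab_le a b
  have : x * (a * b * (a+b) * Z) ≤ 3/4 * (a+b)^3 * x / M^4 := by
    calc x * (a * b * (a+b) * Z) ≤ x * ((a+b)^2/4 * (a+b) * (3 * (1/M^4))) := by gcongr
      _ = _ := by ring
  have h5 : (a+b) * h / M^2 = (a+b) * E := by rw [hE]; ring
  rw [h5]; linarith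

set_option maxHeartbeats 2000000 in
/-- cluster lemma -/
lemma cluster (x h M lam g : ℝ) (hx : 0 < x) (hh : 0 ≤ h) (hM : 0 < M) (hlam : 1 ≤ lam) (hg : 0 < g)
    (hcond : 2 * h * lam^5 * M^3 < 12 * g^3 * x)
    (u v w a : ℕ) (hu : M ≤ u) (hw : ((w + a : ℕ):ℝ) ≤ lam * M) (huv : u < v) (hvw : v < w)
    (ou : Odd u) (ov : Odd v) (ow : Odd w)
    (gu : Good x h u) (gv : Good x h v) (gw : Good x h w)
    (gua : Good x h (u+a)) (gva : Good x h (v+a)) (gwa : Good x h (w+a))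
    (hg1 : g ≤ (v:ℝ) - u) (hg2 : g ≤ (w:ℝ) - v) (hga : g ≤ (a:ℝ)) :
    2 ≤ 3 * a * ((w:ℝ)-u)^3 * x / M^5 + 2 * ((w:ℝ)-u) * h / M^2 := by
  have huv' : (u:ℝ) < v := by exact_mod_cast huv
  have hvw' : (v:ℝ) < w := by exact_mod_cast hvw
  have ha0 : (0:ℝ) < a := by linarith
  push_cast at hw
  obtain ⟨e1, hm1, he1, he1'⟩ := mu_spec_M hM hu hh gu
  obtain ⟨e2, hm2, he2, he2'⟩ := mu_spec_M hM (by linarith) hh gv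
  obtain ⟨e3, hm3, he3, he3'⟩ := mu_spec_M hM (by linarith) hh gw
  obtain ⟨f1, hn1, hf1, hf1'⟩ := mu_spec_M hM (by push_cast; linarith) hh gua
  obtain ⟨f2, hn2, hf2, hf2'⟩ := mu_spec_M hM (by push_cast; linarith) hh gva
  obtain ⟨f3, hn3, hf3, hf3'⟩ := mu_spec_M hM (by push_cast; linarith) hh gwa
  set d : ℝ := (v:ℝ) - u with hd
  set b : ℝ := (w:ℝ) - v with hb
  set E := h / M^2 with hE
  have hu0 : (0:ℝ) < u := by linarith
  have hd0 : 0 < d := by linarith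
  have hb0 : 0 < b := by linarith
  set I : ℤ := ((w:ℤ)-v) * (mu x u - mu x (u+a)) - ((w:ℤ)-u) * (mu x v - mu x (v+a))
    + ((v:ℤ)-u) * (mu x w - mu x (w+a)) with hI
  have hIeven : Even I := by
    have e1 : Even ((w:ℤ)-v) := by
      apply Odd.sub_odd <;> exact_mod_cast (by assumption)
    have e2 : Even ((w:ℤ)-u) := by
      apply Odd.sub_odd <;> exact_mod_cast (by assumption)
    have e3 : Even ((v:ℤ)-u) := by
      apply Odd.sub_odd <;> exact_mod_cast (by assumption)
    exact ((e1.mul_right _).sub (e2.mul_right _)).add (e3.mul_right _)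
  have hid := three_id u d b hu0 hd0 hb0
  have hid2 := three_id (u+a) d b (by linarith) hd0 hb0
  have hv' : (u:ℝ) + d = v := by rw [hd]; ring
  have hw' : (v:ℝ) + b = w := by rw [hb]; ring
  have hv2 : (u:ℝ) + a + d = v + a := by rw [hd]; ring
  have hw2 : (v:ℝ) + a + b = w + a := by rw [hb]; ring
  rw [hv', hw'] at hid
  rw [hv2, hw2] at hid2
  obtain ⟨p1, q1⟩ := inv4_diff u v w w M (lam*M) a hM ha0 hu (by linarith) (by linarith) (by linarith) (by linarith) hw (by linarith) hw
  obtain ⟨p2, q2⟩ := inv4_diff u u v w M (lam*M) a hM ha0 hu (by linarith) hu (by linarith) (by linarith) (by linarith) (by linarith) hw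
  obtain ⟨p3, q3⟩ := inv4_diff u v v w M (lam*M) a hM ha0 hu (by linarith) (by linarith) (by linarith) (by linarith) (by linarith) (by linarith) hw
  set Z := (1/((u:ℝ)*v*w*w) + 1/((u:ℝ)*u*v*w) + 1/((u:ℝ)*v*v*w)) -
    (1/(((u:ℝ)+a)*(v+a)*(w+a)*(w+a)) + 1/(((u:ℝ)+a)*(u+a)*(v+a)*(w+a)) + 1/(((u:ℝ)+a)*(v+a)*(v+a)*(w+a))) with hZ
  have hws : (w:ℝ) - u = d + b := by rw [hd, hb]; ring
  have hIr : (I:ℝ) = x * (d * b * (d+b) * Z)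
      + ((b * e1 - (d+b) * e2 + d * e3) - (b * f1 - (d+b) * f2 + d * f3)) := by
    have : d * b * (d+b) * Z = (b / (u:ℝ)^2 - (d+b) / (v:ℝ)^2 + d / (w:ℝ)^2) -
       (b / ((u:ℝ)+a)^2 - (d+b) / ((v:ℝ)+a)^2 + d / ((w:ℝ)+a)^2) := by
      rw [hid, hid2, hZ]; ring
    rw [this, hI]; push_cast; rw [hm1, hm2, hm3, hn1, hn2, hn3]
    push_cast
    rw [hws, ← hb, ← hd]; ring
  have hZlo : 12 * a / (lam*M)^5 ≤ Z := by
    have : 12 * (a:ℝ) / (lam*M)^5 = 3 * (4 * a / (lam*M)^5) := by ring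
    rw [this]; linarith
  have hZhi : Z ≤ 12 * a / M^5 := by
    have : 12 * (a:ℝ) / M^5 = 3 * (4 * a / M^5) := by ring
    rw [this]; linarith
  have hE0 : 0 ≤ E := by positivity
  have herr1 : ((b * e1 - (d+b) * e2 + d * e3) - (b * f1 - (d+b) * f2 + d * f3)) ≤ 2 * (d+b) * E := by
    have k1 : b * e1 ≤ b * E := by gcongr
    have k2 : d * e3 ≤ d * E := by gcongr
    have k3 : (d+b) * f2 ≤ (d+b) * E := by gcongr
    have k4 := mul_pos hb0 hf1
    have k5 := mul_pos hd0 hf3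
    have k6 := mul_pos (add_pos hd0 hb0) he2
    linarith
  have herr2 : -(2 * (d+b) * E) ≤ ((b * e1 - (d+b) * e2 + d * e3) - (b * f1 - (d+b) * f2 + d * f3)) := by
    have k1 : b * f1 ≤ b * E := by gcongr
    have k2 : d * f3 ≤ d * E := by gcongr
    have k3 : (d+b) * e2 ≤ (d+b) * E := by gcongr
    have k4 := mul_pos hb0 he1
    have k5 := mul_pos hd0 he3
    have k6 := mul_pos (add_pos hd0 hb0) hf2
    linarith
  have hIpos : 0 < I := by
    have : (0:ℝ) < I := by
      rw [hIr]
      have hk : 2 * E < x * (g^2 * (12 * g/(lam*M)^5)) := by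
        have e1 : x * (g^2 * (12 * g/(lam*M)^5)) = 12 * g^3 * x / (lam*M)^5 := by ring
        have e2 : 2 * E = 2 * h / M^2 := by rw [hE]; ring
        rw [e1, e2, div_lt_div_iff₀ (by positivity) (by positivity)]
        have : 2 * h * (lam*M)^5 = (2 * h * lam^5 * M^3) * M^2 := by ring
        rw [this]
        exact mul_lt_mul_of_pos_right hcond (by positivity)
      have hab : g^2 ≤ d * b := by rw [sq]; exact mul_le_mul hg1 hg2 hg.le hd0.le
      have h1 : x * (g^2 * (12 * g/(lam*M)^5)) ≤ x * (d * b * Z) := by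
        have h0 : 12 * g / (lam*M)^5 ≤ 12 * a / (lam*M)^5 := by gcongr
        have : 0 ≤ 12 * g/(lam*M)^5 := by positivity
        gcongr; linarith
      have h2 : (d+b) * (2*E) < (d+b) * (x * (d*b*Z)) := by
        apply mul_lt_mul_of_pos_left _ (by linarith); linarith
      have h3 : x * (d * b * (d+b) * Z) = (d+b) * (x * (d*b*Z)) := by ring
      rw [h3]; linarith
    exact_mod_cast this
  have hI2 : 2 ≤ I := by
    obtain ⟨k, hk⟩ := hIeven; omega
  have hI2' : (2:ℝ) ≤ I := by exact_mod_cast hI2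
  rw [hws]
  have h4ab : d * b ≤ (d+b)^2/4 := ab_le d b
  have hZ0 : 0 ≤ Z := le_trans (by positivity) hZlo
  have : x * (d * b * (d+b) * Z) ≤ 3 * a * (d+b)^3 * x / M^5 := by
    calc x * (d * b * (d+b) * Z) ≤ x * ((d+b)^2/4 * (d+b) * (12 * a / M^5)) := by gcongr
      _ = _ := by ring
  have h5 : 2 * (d+b) * h / M^2 = 2 * (d+b) * E := by rw [hE]; ring
  rw [h5]; linarith

/-- gap lemma: if M^3 ≥ 8x, gaps of odd good numbers are at least 4 -/
lemma gap_four (x h M : ℝ) (hx : 0 < x) (hh : 0 ≤ h) (hM : 0 < M)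
    (hM3 : 8 * x ≤ M^3) (hMh : 2 * h < M^2) (W : ℝ) (hW : h * W ≤ 2 * x) (u v : ℕ) (hu : M ≤ u) (huv : u < v)
    (ou : Odd u) (ov : Odd v) (gu : Good x h u) (gv : Good x h v) (hvW : (v:ℝ) ≤ W) : (4:ℝ) ≤ (v:ℝ) - u := by
  by_contra hcon
  push Not at hcon
  have hv4 : v < u + 4 := by
    have : (v:ℝ) < u + 4 := by linarith
    exact_mod_cast this
  have hv2 : v = u + 2 := by
    obtain ⟨k, rfl⟩ := ou
    obtain ⟨l, rfl⟩ := ov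
    omega
  subst hv2
  obtain ⟨e1, hm1, he1, he1'⟩ := mu_spec_M hM hu hh gu
  obtain ⟨e2, hm2, he2, he2'⟩ := mu_spec_M hM (by push_cast; linarith) hh gv
  have hu0 : (0:ℝ) < u := by linarith
  push_cast at hm2
  have hE : h / M^2 < 1/2 := by rw [div_lt_iff₀ (by positivity)]; linarith
  have hid : x / (u:ℝ)^2 - x / ((u:ℝ)+2)^2 = x * (4 * (u + 1)) / ((u:ℝ)^2 * (u+2)^2) := by
    field_simp; ring
  have hup : x / (u:ℝ)^2 - x / ((u:ℝ)+2)^2 ≤ 1/2 := by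
    rw [hid, div_le_iff₀ (by positivity)]
    have h3 : 8 * x ≤ (u:ℝ)^3 := hM3.trans (by gcongr)
    have h4 : (u:ℝ) * (u+1) ≤ (u+2)^2 := by nlinarith
    nlinarith [mul_le_mul_of_nonneg_right h3 (by positivity : (0:ℝ) ≤ (u+1)),
      mul_le_mul_of_nonneg_left h4 (by positivity : (0:ℝ) ≤ (u:ℝ)^2)]
  obtain ⟨e3, hm3, he3, he3'⟩ := mu_spec (by omega) gv
  push_cast at hm3 he3' hvW
  have e23 : e2 = e3 := by linarith
  have hlow : h / ((u:ℝ)+2)^2 ≤ x / (u:ℝ)^2 - x / ((u:ℝ)+2)^2 := by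
    rw [hid, div_le_div_iff₀ (by positivity) (by positivity)]
    have h1 : h * (u + 2) ≤ 2 * x := le_trans (by gcongr) hW
    have h2 : h * u^2 ≤ x * (4 * (u+1)) := by nlinarith
    calc h * ((u:ℝ)^2 * (u+2)^2) = (h * u^2) * (u+2)^2 := by ring
      _ ≤ _ := by gcongr
  have h1 : (mu x (u+2) : ℝ) < mu x u := by rw [hm1, hm2]; linarith
  have h2 : (mu x u : ℝ) < mu x (u+2) + 1 := by rw [hm1, hm2]; linarith
  have h1' : mu x (u+2) < mu x u := by exact_mod_cast h1
  have h2' : mu x u < mu x (u+2) + 1 := by exact_mod_cast h2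
  omega

/-- two point tail -/
lemma two_pt (x h R : ℝ) (hx : 0 < x) (hh : 0 ≤ h) (hR : 0 < R) (hhR : h ≤ 2 * R)
    (T : Finset ℕ) (hT : ∀ u ∈ T, R ≤ u ∧ Good x h u) : (T.card : ℝ) ≤ (x + h) / R^2 := by
  have hinj : Set.InjOn (mu x) T := by
    have key : ∀ u ∈ T, ∀ v ∈ T, u < v → mu x u ≠ mu x v := by
      intro u hu v hv huv heq
      obtain ⟨e1, hm1, he1, he1'⟩ := mu_spec_M hR (hT u hu).1 hh (hT u hu).2
      obtain ⟨e2, hm2, he2, he2'⟩ := mu_spec_M hR (hT v hv).1 hh (hT v hv).2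
      have hu0 : (0:ℝ) < u := hR.trans_le (hT u hu).1
      have hv0 : (0:ℝ) < v := hR.trans_le (hT v hv).1
      obtain ⟨f1, hn1, hf1, hf1'⟩ := mu_spec (by exact_mod_cast hu0) (hT u hu).2
      obtain ⟨f2, hn2, hf2, hf2'⟩ := mu_spec (by exact_mod_cast hv0) (hT v hv).2
      have huv' : (u:ℝ) + 1 ≤ v := by exact_mod_cast huv
      have hr : (mu x u : ℝ) = mu x v := by rw [heq]
      have hm0 : (1:ℝ) ≤ mu x v := by
        have : (0:ℝ) < mu x v := by rw [hn2]; positivity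
        have : (0:ℤ) < mu x v := by exact_mod_cast this
        exact_mod_cast this
      have h1 : (mu x v : ℝ) * (v:ℝ)^2 ≤ x + h := by
        rw [hn2]
        have : (x / (v:ℝ)^2 + f2) * (v:ℝ)^2 = x + f2 * (v:ℝ)^2 := by field_simp
        rw [this]
        rw [le_div_iff₀ (by positivity)] at hf2'
        linarith
      have h2 : x < (mu x u : ℝ) * (u:ℝ)^2 := by
        rw [hn1]
        have : (x / (u:ℝ)^2 + f1) * (u:ℝ)^2 = x + f1 * (u:ℝ)^2 := by field_simp
        rw [this]
        have : 0 < f1 * (u:ℝ)^2 := by positivity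
        linarith
      rw [hr] at h2
      have h3 : (mu x v : ℝ) * ((v:ℝ)^2 - (u:ℝ)^2) < h := by linarith
      have h4 : 2 * R + 1 ≤ (v:ℝ)^2 - (u:ℝ)^2 := by nlinarith [(hT u hu).1]
      nlinarith
    intro u hu v hv heq
    rcases lt_trichotomy u v with h1 | h1 | h1
    · exact absurd heq (key u hu v hv h1)
    · exact h1
    · exact absurd heq.symm (key v hv u hu h1)
  have h1 : (T.image (mu x)).card = T.card := Finset.card_image_of_injOn hinj
  rw [← h1]
  have := card_int_le (T.image (mu x)) 1 (max 1 ((x+h)/R^2)) (by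
    intro m hm
    obtain ⟨u, hu, rfl⟩ := Finset.mem_image.1 hm
    have hu0 : (0:ℝ) < u := hR.trans_le (hT u hu).1
    obtain ⟨f1, hn1, hf1, hf1'⟩ := mu_spec (by exact_mod_cast hu0) (hT u hu).2
    constructor
    · have : (0:ℝ) < mu x u := by rw [hn1]; positivity
      have : (0:ℤ) < mu x u := by exact_mod_cast this
      exact_mod_cast this
    · apply le_max_of_le_right
      have : (mu x u : ℝ) ≤ (x + h) / (u:ℝ)^2 := by rw [hn1, add_div]; linarith
      refine this.trans ?_
      have := (hT u hu).1
      gcongr) (le_max_left _ _)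
  rcases T.eq_empty_or_nonempty with rfl | ⟨u, hu⟩
  · simp; positivity
  have h5 : 1 ≤ (x+h)/R^2 := by
    have hu0 : (0:ℝ) < u := hR.trans_le (hT u hu).1
    obtain ⟨f1, hn1, hf1, hf1'⟩ := mu_spec (by exact_mod_cast hu0) (hT u hu).2
    have h6 : (0:ℝ) < mu x u := by rw [hn1]; positivity
    have h7 : (0:ℤ) < mu x u := by exact_mod_cast h6
    have h8 : (1:ℝ) ≤ mu x u := by exact_mod_cast h7
    have h9 : (mu x u : ℝ) ≤ (x + h) / (u:ℝ)^2 := by rw [hn1, add_div]; linarith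
    refine h8.trans (h9.trans ?_)
    have := (hT u hu).1
    gcongr
  rw [max_eq_right h5] at this
  linarith
end SFI

namespace SFI
open Finset

noncomputable def NN (x : ℝ) (a u : ℕ) : ℤ :=
  (2 * (u:ℤ) + 3 * a) * mu x (u+a) - (2 * (u:ℤ) - a) * mu x u

lemma NN_even (x : ℝ) (a u : ℕ) (ha : Even a) : Even (NN x a u) := by
  have ha' : Even (a:ℤ) := by exact_mod_cast ha
  unfold NN
  apply Even.sub
  · apply Even.mul_right
    exact (even_two_mul _).add (ha'.mul_left _)
  · apply Even.mul_right
    exact (even_two_mul _).sub ha'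

lemma NN_err (x h M : ℝ) (hh : 0 ≤ h) (hM : 0 < M) (a u : ℕ) (hu : M ≤ u)
    (hau : (a:ℝ) ≤ 2 * u) (gu : Good x h u) (gua : Good x h (u+a)) :
    |(NN x a u : ℝ) - (a:ℝ)^3 * x * (1 / ((u:ℝ)*u*(u+a)*(u+a)))| ≤ 2 * h / M := by
  have hu0 : (0:ℝ) < u := by linarith
  have hun : 0 < u := by exact_mod_cast hu0
  obtain ⟨e, hm1, he, he'⟩ := mu_spec hun gu
  obtain ⟨f, hm2, hf, hf'⟩ := mu_spec (by omega) gua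
  push_cast at hm2 hf'
  have ha0 : (0:ℝ) ≤ a := by positivity
  have hid : (NN x a u : ℝ) - (a:ℝ)^3 * x * (1 / ((u:ℝ)*u*(u+a)*(u+a))) =
      (2*u+3*a) * f - (2*u-a)*e := by
    unfold NN; push_cast; rw [hm1, hm2]
    have : (u:ℝ) + a ≠ 0 := by positivity
    field_simp
    ring
  rw [hid]
  have hA : (2*u+3*a) * f ≤ 2 * h / u := by
    calc (2*(u:ℝ)+3*a) * f ≤ (2*u+3*a) * (h / (u+a)^2) := by gcongr
      _ ≤ 2 * h / u := by
        rw [mul_div_assoc', div_le_div_iff₀ (by positivity) hu0]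
        have : (2*(u:ℝ)+3*a) * u ≤ 2 * (u+a)^2 := by nlinarith [mul_nonneg hu0.le ha0]
        nlinarith [mul_le_mul_of_nonneg_left this hh]
  have hB : (2*u-a) * e ≤ 2 * h / u := by
    calc (2*(u:ℝ)-a) * e ≤ (2*u) * (h / u^2) := by
          apply mul_le_mul (by linarith) he' he.le (by linarith)
      _ = 2 * h / u := by field_simp
  have hC : 2 * h / u ≤ 2 * h / M := by gcongr
  have hA0 : 0 ≤ (2*u+3*a) * f := by positivity
  have hB0 : 0 ≤ (2*u-a) * e := mul_nonneg (by linarith) he.le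
  rw [abs_le]
  constructor <;> linarith

lemma NN_close (x h M lam : ℝ) (hx : 0 < x) (hh : 0 ≤ h) (hM : 0 < M) (hlam : 1 ≤ lam) (a u v : ℕ)
    (ha : 0 < a) (hu : M ≤ u) (huv : u < v)
    (hv : (v:ℝ) + a ≤ lam * M) (hau : (a:ℝ) ≤ 2 * M) (gu : Good x h u) (gua : Good x h (u+a))
    (gv : Good x h v) (gva : Good x h (v+a)) (hN : NN x a u = NN x a v) :
    (v:ℝ) - u ≤ lam^5 * h * M^4 / ((a:ℝ)^3 * x) := by
  have huv' : (u:ℝ) < v := by exact_mod_cast huv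
  have ha0 : (0:ℝ) < a := by exact_mod_cast ha
  have h1 := abs_le.1 (NN_err x h M hh hM a u hu (by linarith) gu gua)
  have h2 := abs_le.1 (NN_err x h M hh hM a v (by linarith) (by linarith) gv gva)
  rw [hN] at h1
  set d := (v:ℝ) - u with hd
  have h3 := (inv4_diff u u (u+a) (u+a) M (lam*M) d hM (by linarith) hu (by linarith) hu (by linarith)
    (by linarith) (by linarith) (by linarith) (by linarith)).1
  have e1 : (u:ℝ) + d = v := by rw [hd]; ring
  have e2 : (u:ℝ) + a + d = v + a := by rw [hd]; ring
  rw [e1, e2] at h3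
  set p := 1 / ((u:ℝ)*u*(u+a)*(u+a))
  set q := 1 / ((v:ℝ)*v*(v+a)*(v+a))
  have h4 : (a:ℝ)^3 * x * (p - q) ≤ 4 * h / M := by
    have : 4 * h / M = 2 * h / M + 2 * h / M := by ring
    rw [this]; linarith [h1.1, h2.2]
  have h5 : (a:ℝ)^3 * x * (4 * d / (lam*M)^5) ≤ 4 * h / M := le_trans (by gcongr) h4
  rw [le_div_iff₀ (by positivity)]
  rw [mul_div_assoc', div_le_div_iff₀ (by positivity) hM] at h5
  have h6 : (lam*M)^5 = lam^5*M^4*M := by ring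
  rw [h6] at h5
  have h7 : (d * ((a:ℝ)^3*x)) * (4*M) ≤ (lam^5*h*M^4) * (4*M) := by linarith
  exact le_of_mul_le_mul_right h7 (by positivity)

/-- block hypothesis -/
structure Blk (X h t : ℝ) (T : Finset ℕ) : Prop where
  X1 : 1 ≤ X
  h0 : 0 < h
  t0 : 0 < t
  mem : ∀ u ∈ T, t^3 ≤ u ∧ (u:ℝ) ≤ 1.093 * t^3 ∧ Odd u ∧ Good (X^15) h u
  sm : 9 * h ≤ t^2 * X^5
  alt : h * 1.4272 * t^6 < 12 * X^15 ∨
    (8 * X^15 ≤ t^9 ∧ 2 * h < t^6 ∧ h * (1.093 * t^3) ≤ 2 * X^15 ∧ h * 1.4272 * t^6 < 48 * X^15)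

lemma Blk.sep {X h t : ℝ} {T : Finset ℕ} (B : Blk X h t T) :
    ∀ u ∈ T, ∀ v ∈ T, ∀ w ∈ T, u < v → v < w → 1.35 * t^4 / X^5 ≤ (w:ℝ) - u := by
  intro u hu v hv w hw huv hvw
  obtain ⟨X1, h0, t0, mem, sm, alt⟩ := B
  have X0 : 0 < X := by linarith
  obtain ⟨u1, u2, u3, u4⟩ := mem u hu
  obtain ⟨v1, v2, v3, v4⟩ := mem v hv
  obtain ⟨w1, w2, w3, w4⟩ := mem w hw
  have huv' : (u:ℝ) + 2 ≤ v := by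
    have : u + 2 ≤ v := by
      obtain ⟨k, rfl⟩ := u3; obtain ⟨l, rfl⟩ := v3; omega
    exact_mod_cast this
  have hvw' : (v:ℝ) + 2 ≤ w := by
    have : v + 2 ≤ w := by
      obtain ⟨k, rfl⟩ := v3; obtain ⟨l, rfl⟩ := w3; omega
    exact_mod_cast this
  have hlam : h * 1.093^4 * (t^3)^2 ≤ h * 1.4272 * t^6 := by
    have : h * 1.4272 * t^6 = h * 1.4272 * (t^3)^2 := by ring
    rw [this]; gcongr; norm_num
  have key : 2 ≤ 3/4 * ((w:ℝ)-u)^3 * X^15 / (t^3)^4 + ((w:ℝ)-u) * h / (t^3)^2 := by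
    rcases alt with hA | ⟨a1, a2, a3, a4⟩
    · exact three_pt (X^15) h (t^3) 1.093 2 (by positivity) h0.le (by positivity) (by norm_num)
        (by norm_num) (by linarith) u v w u1 w2 huv hvw u3 v3 w3 u4 v4 w4 (by linarith) (by linarith)
    · have g1 := gap_four (X^15) h (t^3) (by positivity) h0.le (by positivity)
        (by rw [← pow_mul]; exact a1) (by rw [← pow_mul]; exact a2) (1.093*t^3) a3 u v u1 huv u3 v3 u4 v4 v2
      have g2 := gap_four (X^15) h (t^3) (by positivity) h0.le (by positivity)
        (by rw [← pow_mul]; exact a1) (by rw [← pow_mul]; exact a2) (1.093*t^3) a3 v w v1 hvw v3 w3 v4 w4 w2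
      exact three_pt (X^15) h (t^3) 1.093 4 (by positivity) h0.le (by positivity) (by norm_num)
        (by norm_num) (by linarith) u v w u1 w2 huv hvw u3 v3 w3 u4 v4 w4 g1 g2
  by_contra hcon
  push Not at hcon
  have hs0 : 0 < (w:ℝ) - u := by linarith
  have b1 : 3/4 * ((w:ℝ)-u)^3 * X^15 / (t^3)^4 ≤ 3/4 * 1.35^3 := by
    calc 3/4 * ((w:ℝ)-u)^3 * X^15 / (t^3)^4 ≤ 3/4 * (1.35 * t^4 / X^5)^3 * X^15 / (t^3)^4 := by gcongr
      _ = 3/4 * 1.35^3 := by field_simp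
  have b2 : ((w:ℝ)-u) * h / (t^3)^2 ≤ 0.15 := by
    calc ((w:ℝ)-u) * h / (t^3)^2 ≤ (1.35 * t^4 / X^5) * h / (t^3)^2 := by gcongr
      _ = 0.15 * (9 * h) / (t^2 * X^5) := by field_simp; norm_num
      _ ≤ 0.15 := by
        rw [div_le_iff₀ (by positivity)]; linarith
  norm_num at b1 b2
  linarith

lemma Blk.boundB {X h t : ℝ} {T : Finset ℕ} (B : Blk X h t T) :
    (T.card : ℝ) ≤ 0.13778 * X^5 / t + 2 := by
  have hsep := B.sep
  obtain ⟨X1, h0, t0, mem, sm, alt⟩ := B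
  have X0 : 0 < X := by linarith
  have ht3 : 0 < t^3 := by positivity
  have := card_three T (t^3) (1.093*t^3) (1.35 * t^4 / X^5) (by positivity) (by linarith)
    (fun u hu => ⟨(mem u hu).1, (mem u hu).2.1⟩) hsep
  refine this.trans ?_
  have e : 2 * ((1.093 * t^3 - t^3) / (1.35 * t^4 / X^5)) = (0.186/1.35) * (X^5/t) := by
    field_simp; ring
  rw [e, mul_div_assoc]
  have : 0 < X^5/t := by positivity
  norm_num at this ⊢
  nlinarith

/-- crude sum of inverse cubes -/
lemma sum_inv_cube_crude (I : Finset ℕ) (s0 : ℝ) (h0 : 0 < s0) (hI : ∀ a ∈ I, Even a ∧ 0 < a ∧ s0 ≤ a) :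
    ∑ a ∈ I, 1 / (a:ℝ) ^ 3 ≤ 0.62 / s0^2 := by
  by_cases h2 : s0 ≤ 2
  · have h1 : ∑ a ∈ I.erase 2, 1 / (a:ℝ) ^ 3 ≤ 1 / (4 * ((4:ℝ) - 1) ^ 2) := by
      apply sum_inv_cube_I _ 4 (by norm_num)
      intro a ha
      rw [Finset.mem_erase] at ha
      obtain ⟨b1, b2, b3⟩ := hI a ha.2
      refine ⟨b1, ?_⟩
      have : 4 ≤ a := by obtain ⟨k, hk⟩ := b1; have := ha.1; omega
      exact_mod_cast this
    have h3 : ∑ a ∈ I, 1 / (a:ℝ) ^ 3 ≤ ∑ a ∈ insert 2 (I.erase 2), 1 / (a:ℝ) ^ 3 := by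
      apply Finset.sum_le_sum_of_subset_of_nonneg
      · exact Finset.insert_erase_subset 2 I
      · intros; positivity
    rw [Finset.sum_insert (Finset.notMem_erase 2 I)] at h3
    have h4 : 0.62/4 ≤ 0.62 / s0^2 := by
      gcongr; nlinarith
    norm_num at h1 h3 h4 ⊢
    linarith
  · push Not at h2
    have h1 : ∑ a ∈ I, 1 / (a:ℝ) ^ 3 ≤ 1 / (4 * ((max 4 s0) - 1) ^ 2) := by
      apply sum_inv_cube_I _ _ (lt_max_of_lt_left (by norm_num))
      intro a ha
      obtain ⟨b1, b2, b3⟩ := hI a ha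
      refine ⟨b1, max_le ?_ b3⟩
      have h2a : (2:ℝ) < a := by linarith
      have h2a' : 2 < a := by exact_mod_cast h2a
      have : 4 ≤ a := by obtain ⟨k, hk⟩ := b1; omega
      exact_mod_cast this
    refine h1.trans ?_
    rcases le_total s0 4 with h4 | h4
    · rw [max_eq_left h4, div_le_div_iff₀ (by norm_num) (by positivity)]
      nlinarith
    · rw [max_eq_right h4, div_le_div_iff₀ (by nlinarith) (by positivity)]
      nlinarith

lemma sum_inv_cube_fine (I : Finset ℕ) (s0 : ℝ) (h0 : 9.5 ≤ s0) (hI : ∀ a ∈ I, Even a ∧ 0 < a ∧ s0 ≤ a) :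
    ∑ a ∈ I, 1 / (a:ℝ) ^ 3 ≤ 0.3125 / s0^2 := by
  refine (sum_inv_cube_I I s0 (by linarith) (fun a ha => ⟨(hI a ha).1, (hI a ha).2.2⟩)).trans ?_
  rw [div_le_div_iff₀ (by nlinarith) (by nlinarith)]
  nlinarith
end SFI

namespace SFI
open Finset

/-- cluster separation inside a set with all gaps at least `s0` -/
lemma Blk.sep1 {X h t : ℝ} {T : Finset ℕ} (B : Blk X h t T) (h2 : 2 * h ≤ t^3)
    (sm2 : 13 * h ≤ t^2 * X^4) (T' : Finset ℕ) (hT' : T' ⊆ T)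
    (hgap : ∀ u ∈ T', ∀ w ∈ T', u < w → 1.35 * t^4 / X^5 ≤ (w:ℝ) - u)
    (a : ℕ) (ha : 1.35 * t^4 / X^5 ≤ a) (haA : (a:ℝ) ≤ t^3 / (8 * X^3)) :
    ∀ u ∈ T', ∀ v ∈ T', ∀ w ∈ T', u + a ∈ T' → v + a ∈ T' → w + a ∈ T' → u < v → v < w →
      (5/3) * t^4 / X^4 ≤ (w:ℝ) - u := by
  intro u hu v hv w hw hua hva hwa huv hvw
  obtain ⟨X1, h0, t0, mem, sm, alt⟩ := B
  have X0 : 0 < X := by linarith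
  obtain ⟨u1, u2, u3, u4⟩ := mem u (hT' hu)
  obtain ⟨v1, v2, v3, v4⟩ := mem v (hT' hv)
  obtain ⟨w1, w2, w3, w4⟩ := mem w (hT' hw)
  obtain ⟨-, -, -, ua4⟩ := mem _ (hT' hua)
  obtain ⟨-, -, -, va4⟩ := mem _ (hT' hva)
  obtain ⟨-, wa2, -, wa4⟩ := mem _ (hT' hwa)
  have g1 := hgap u hu v hv huv
  have g2 := hgap v hv w hw hvw
  have key := cluster (X^15) h (t^3) 1.093 (1.35 * t^4 / X^5) (by positivity) h0.le (by positivity)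
    (by norm_num) (by positivity) (by
      have e : 12 * (1.35 * t^4 / X^5)^3 * X^15 = (12 * 1.35^3) * t^3 * (t^3)^3 := by field_simp
      rw [e]
      have : 2 * h * 1.093^5 * (t^3)^3 = (2 * h * 1.093^5) * (t^3)^3 := by ring
      rw [this]
      apply mul_lt_mul_of_pos_right _ (by positivity)
      norm_num
      linarith) u v w a u1 wa2 huv hvw u3 v3 w3 u4 v4 w4 ua4 va4 wa4 g1 g2 ha
  by_contra hcon
  push Not at hcon
  have hs0 : 0 < (w:ℝ) - u := by
    have : 0 < 1.35 * t^4 / X^5 := by positivity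
    linarith
  have b1 : 3 * a * ((w:ℝ)-u)^3 * X^15 / (t^3)^5 ≤ 125/72 := by
    calc 3 * a * ((w:ℝ)-u)^3 * X^15 / (t^3)^5
        ≤ 3 * (t^3 / (8 * X^3)) * ((5/3) * t^4 / X^4)^3 * X^15 / (t^3)^5 := by gcongr
      _ = 125/72 := by field_simp; norm_num
  have b2 : 2 * ((w:ℝ)-u) * h / (t^3)^2 ≤ 0.26 := by
    calc 2 * ((w:ℝ)-u) * h / (t^3)^2 ≤ 2 * ((5/3) * t^4 / X^4) * h / (t^3)^2 := by gcongr
      _ = (10/39) * (13 * h) / (t^2 * X^4) := by field_simp; norm_num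
      _ ≤ 0.26 := by
        rw [div_le_iff₀ (by positivity)]
        have : 0 < t^2 * X^4 := by positivity
        norm_num; nlinarith
  norm_num at b1 b2
  linarith

lemma Blk.boundG {X h t : ℝ} {T : Finset ℕ} (B : Blk X h t T) (h2 : 2 * h ≤ t^3)
    (sm2 : 13 * h ≤ t^2 * X^4) (T' : Finset ℕ) (hT' : T' ⊆ T)
    (hgap : ∀ u ∈ T', ∀ w ∈ T', u < w → 1.35 * t^4 / X^5 ≤ (w:ℝ) - u)
    (a : ℕ) (hae : Even a) (ha : 1.35 * t^4 / X^5 ≤ a) (haA : (a:ℝ) ≤ t^3 / (8 * X^3)) :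
    ((T'.filter (fun u => u + a ∈ T')).card : ℝ) ≤
      (1.872 * h * t^8 / ((a:ℝ)^3 * X^11) + 2) * (0.15 * (a:ℝ)^3 * X^15 / t^12 + 2 * h / t^3 + 1) := by
  have hcl := B.sep1 h2 sm2 T' hT' hgap a ha haA
  obtain ⟨X1, h0, t0, mem, sm, alt⟩ := B
  have X0 : 0 < X := by linarith
  have ha0 : (0:ℝ) < a := lt_of_lt_of_le (by positivity) ha
  have han : 0 < a := by exact_mod_cast ha0
  have ha2 : (a:ℝ) ≤ 2 * t^3 := by
    refine haA.trans ?_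
    rw [div_le_iff₀ (by positivity)]
    have : 1 ≤ X^3 := one_le_pow₀ X1
    nlinarith [pow_pos t0 3]
  set G := T'.filter (fun u => u + a ∈ T') with hG
  have hmemG : ∀ u ∈ G, u ∈ T' ∧ u + a ∈ T' := fun u hu => Finset.mem_filter.1 hu
  set Y := (a:ℝ)^3 * X^15 with hY
  have hY0 : 0 < Y := by positivity
  have hrange : ∀ u ∈ G, Y * (1 / (1.093*t^3)^4) - 2 * h / t^3 ≤ NN (X^15) a u ∧
      (NN (X^15) a u : ℝ) ≤ Y * (1 / (t^3)^4) + 2 * h / t^3 := by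
    intro u hu
    obtain ⟨hu1, hu2⟩ := hmemG u hu
    obtain ⟨u1, u2, u3, u4⟩ := mem u (hT' hu1)
    obtain ⟨v1, v2, v3, v4⟩ := mem _ (hT' hu2)
    push_cast at v1 v2
    have := abs_le.1 (NN_err (X^15) h (t^3) h0.le (by positivity) a u u1 (by linarith) u4 v4)
    obtain ⟨i1, i2⟩ := inv4_bounds u u (u+a) (u+a) (t^3) (1.093*t^3) (by positivity) u1 u2 u1 u2 v1 v2 v1 v2
    have j1 := mul_le_mul_of_nonneg_left i1 hY0.le
    have j2 := mul_le_mul_of_nonneg_left i2 hY0.le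
    constructor <;> linarith [this.1, this.2]
  have hhalf : ∀ u : ℕ, ((NN (X^15) a u / 2 : ℤ) : ℝ) = (NN (X^15) a u : ℝ) / 2 := by
    intro u
    obtain ⟨k, hk⟩ := NN_even (X^15) a u hae
    have : NN (X^15) a u / 2 = k := by omega
    rw [this, hk]; push_cast; ring
  have hD0 : 0 ≤ 1.093^5 * h * (t^3)^4 / ((a:ℝ)^3 * X^15) := by positivity
  have hfib : ∀ N : ℤ, ((G.filter (fun u => NN (X^15) a u / 2 = N)).card : ℝ) ≤
      1.872 * h * t^8 / ((a:ℝ)^3 * X^11) + 2 := by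
    intro N
    set H := G.filter (fun u => NN (X^15) a u / 2 = N) with hH
    rcases H.eq_empty_or_nonempty with he | hne
    · rw [he]; simp only [Finset.card_empty, Nat.cast_zero]; positivity
    have hmH : ∀ u ∈ H, u ∈ G ∧ NN (X^15) a u / 2 = N := fun u hu => Finset.mem_filter.1 hu
    have hNN : ∀ u ∈ H, ∀ v ∈ H, NN (X^15) a u = NN (X^15) a v := by
      intro u hu v hv
      have h1 := (hmH u hu).2
      have h2 := (hmH v hv).2
      obtain ⟨k, hk⟩ := NN_even (X^15) a u hae
      obtain ⟨l, hl⟩ := NN_even (X^15) a v hae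
      omega
    set u0 := H.min' hne with hu0
    have hu0H : u0 ∈ H := H.min'_mem hne
    have hcard := card_three H u0 (u0 + 1.093^5 * h * (t^3)^4 / ((a:ℝ)^3 * X^15)) ((5/3) * t^4 / X^4)
      (by positivity) (by linarith) (by
        intro v hv
        have hle : u0 ≤ v := H.min'_le v hv
        refine ⟨by exact_mod_cast hle, ?_⟩
        rcases hle.eq_or_lt with h1 | h1
        · rw [← h1]; linarith
        · obtain ⟨hu1, hu2⟩ := hmemG u0 (hmH u0 hu0H).1
          obtain ⟨hv1, hv2⟩ := hmemG v (hmH v hv).1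
          have := NN_close (X^15) h (t^3) 1.093 (by positivity) h0.le (by positivity) (by norm_num) a u0 v
            han (mem _ (hT' hu1)).1 h1 (by have := (mem _ (hT' hv2)).2.1; push_cast at this; exact this)
            ha2 (mem _ (hT' hu1)).2.2.2 (mem _ (hT' hu2)).2.2.2 (mem _ (hT' hv1)).2.2.2
            (mem _ (hT' hv2)).2.2.2 (hNN u0 hu0H v hv)
          linarith) (by
        intro u hu v hv w hw huv hvw
        obtain ⟨hu1, hu2⟩ := hmemG u (hmH u hu).1
        obtain ⟨hv1, hv2⟩ := hmemG v (hmH v hv).1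
        obtain ⟨hw1, hw2⟩ := hmemG w (hmH w hw).1
        exact hcl u hu1 v hv1 w hw1 hu2 hv2 hw2 huv hvw)
    refine hcard.trans ?_
    have e : 2 * (((u0:ℝ) + 1.093^5 * h * (t^3)^4 / ((a:ℝ)^3 * X^15) - u0) / ((5/3) * t^4 / X^4)) =
        (6/5 * 1.093^5) * (h * t^8 / ((a:ℝ)^3 * X^11)) := by
      field_simp; ring
    rw [e]
    have e2 : 1.872 * h * t^8 / ((a:ℝ)^3 * X^11) = 1.872 * (h * t^8 / ((a:ℝ)^3 * X^11)) := by ring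
    rw [e2]
    have : 0 < h * t^8 / ((a:ℝ)^3 * X^11) := by positivity
    gcongr
    norm_num
  have hz : 0 ≤ 2 * h / t^3 := by positivity
  have hlohi : (Y * (1 / (1.093*t^3)^4) - 2 * h / t^3)/2 ≤ (Y * (1 / (t^3)^4) + 2 * h / t^3)/2 := by
    have : Y * (1 / (1.093*t^3)^4) ≤ Y * (1 / (t^3)^4) := by
      gcongr
      nlinarith [pow_pos t0 3]
    linarith
  have hfin := card_fibre G (fun u => NN (X^15) a u / 2) ((Y * (1 / (1.093*t^3)^4) - 2 * h / t^3)/2)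
    ((Y * (1 / (t^3)^4) + 2 * h / t^3)/2) (1.872 * h * t^8 / ((a:ℝ)^3 * X^11) + 2) hlohi
    (by positivity) (by
      intro u hu
      have := hrange u hu
      simp only [hhalf]
      constructor <;> linarith [this.1, this.2]) hfib
  refine hfin.trans ?_
  gcongr
  have e3 : Y * (1 / (1.093*t^3)^4) = (1/1.093^4) * (Y / t^12) := by field_simp
  have e4 : Y * (1 / (t^3)^4) = Y / t^12 := by field_simp
  have e5 : 0.15 * (a:ℝ)^3 * X^15 / t^12 = 0.15 * (Y/t^12) := by rw [hY]; ring
  rw [e3, e4, e5]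
  have : 0 < Y / t^12 := by positivity
  norm_num
  linarith

lemma Blk.boundD {X h t e : ℝ} {T : Finset ℕ} (B : Blk X h t T) (h2 : 2 * h ≤ t^3)
    (sm2 : 13 * h ≤ t^2 * X^4)
    (he : ∀ I : Finset ℕ, (∀ a ∈ I, Even a ∧ 0 < a ∧ 1.35 * t^4 / X^5 ≤ a) →
      ∑ a ∈ I, 1 / (a:ℝ) ^ 3 ≤ e / (1.35 * t^4 / X^5)^2) :
    (T.card : ℝ) ≤ 2 + 1.48808 * X^3 + t^3 / (2 * X^3) + 0.0351 * h * X / t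
      + 2.0544 * e * (1 + 2 * h / t^3) * (h / X) := by
  classical
  have hB := B
  obtain ⟨X1, h0, t0, mem, sm, alt⟩ := B
  have X0 : 0 < X := by linarith
  obtain ⟨T', hT', hc, hbet⟩ := exists_half T.card T le_rfl
  have hgap : ∀ u ∈ T', ∀ w ∈ T', u < w → 1.35 * t^4 / X^5 ≤ (w:ℝ) - u := by
    intro u hu w hw huw
    obtain ⟨v, hv, h1, h2⟩ := hbet u hu w hw huw
    exact hB.sep u (hT' hu) v hv w (hT' hw) h1 h2
  set A := t^3 / (8 * X^3) with hA
  set s0 := 1.35 * t^4 / X^5 with hs0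
  have hs00 : 0 < s0 := by positivity
  have hA0 : 0 < A := by positivity
  set I := (Finset.Icc 1 ⌊A⌋₊).filter (fun a : ℕ => Even a ∧ s0 ≤ (a:ℝ)) with hI
  have hImem : ∀ a ∈ I, Even a ∧ 0 < a ∧ s0 ≤ a ∧ (a:ℝ) ≤ A := by
    intro a ha
    rw [hI, Finset.mem_filter, Finset.mem_Icc] at ha
    exact ⟨ha.2.1, ha.1.1, ha.2.2, (Nat.le_floor_iff hA0.le).1 ha.1.2⟩
  have hcardI : (I.card : ℝ) ≤ A / 2 := by
    have hsub : I ⊆ (Finset.Icc 1 (⌊A⌋₊/2)).image (fun k => 2 * k) := by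
      intro a ha
      rw [hI, Finset.mem_filter, Finset.mem_Icc] at ha
      obtain ⟨⟨a1, a2⟩, ⟨k, hk⟩, -⟩ := ha
      rw [Finset.mem_image]
      exact ⟨k, by rw [Finset.mem_Icc]; omega, by omega⟩
    have h1 := (Finset.card_le_card hsub).trans Finset.card_image_le
    rw [Nat.card_Icc] at h1
    have h3 : 2 * I.card ≤ ⌊A⌋₊ := by omega
    have h4 : (2:ℝ) * I.card ≤ A := by
      refine le_trans ?_ (Nat.floor_le hA0.le)
      exact_mod_cast h3
    linarith
  have hgapcard := card_gap T' (t^3) (1.093*t^3) A hA0 (by nlinarith [pow_pos t0 3])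
    (fun u hu => ⟨(mem u (hT' hu)).1, (mem u (hT' hu)).2.1⟩) I (by
      intro u hu w hw huw hle
      rw [hI, Finset.mem_filter, Finset.mem_Icc]
      have hcast : ((w - u : ℕ):ℝ) = (w:ℝ) - u := by push_cast [huw.le]; ring
      refine ⟨⟨by omega, ?_⟩, ?_, ?_⟩
      · rw [Nat.le_floor_iff hA0.le, hcast]; exact hle
      · exact Nat.Odd.sub_odd (mem w (hT' hw)).2.2.1 (mem u (hT' hu)).2.2.1
      · rw [hcast]; exact hgap u hu w hw huw)
  set ε := 2 * h / t^3 with hε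
  have hε0 : 0 ≤ ε := by positivity
  have hε1 : ε ≤ 1 := by rw [hε, div_le_one (by positivity)]; exact h2
  have hterm : ∀ a ∈ I, ((T'.filter (fun u => u + a ∈ T')).card : ℝ) ≤
      (0.2808 * h * X^4 / t^4 + 0.3 * A^3 * X^15 / t^12 + 4) +
      (1.872 * (1 + ε) * h * t^8 / X^11) * (1 / (a:ℝ)^3) := by
    intro a ha
    obtain ⟨a1, a2, a3, a4⟩ := hImem a ha
    have ha0 : (0:ℝ) < a := by exact_mod_cast a2
    have := hB.boundG h2 sm2 T' hT' hgap a a1 a3 a4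
    refine this.trans ?_
    have e1 : (1.872 * h * t^8 / ((a:ℝ)^3 * X^11) + 2) * (0.15 * (a:ℝ)^3 * X^15 / t^12 + 2 * h / t^3 + 1)
      = 0.2808 * h * X^4 / t^4 + 0.3 * (a:ℝ)^3 * X^15 / t^12 + 2 * (1 + ε) +
      (1.872 * (1 + ε) * h * t^8 / X^11) * (1 / (a:ℝ)^3) := by
        rw [hε]; field_simp; ring
    rw [e1]
    have h3 : 0.3 * (a:ℝ)^3 * X^15 / t^12 ≤ 0.3 * A^3 * X^15 / t^12 := by gcongr
    linarith
  have hsum := Finset.sum_le_sum hterm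
  rw [Finset.sum_add_distrib, ← Finset.mul_sum, Finset.sum_const, nsmul_eq_mul] at hsum
  have hcub := he I (fun a ha => ⟨(hImem a ha).1, (hImem a ha).2.1, (hImem a ha).2.2.1⟩)
  have hp1 : (I.card:ℝ) * (0.2808 * h * X^4 / t^4 + 0.3 * A^3 * X^15 / t^12 + 4) ≤
      0.01755 * h * X / t + 0.000037 * X^3 + t^3 / (4 * X^3) := by
    calc (I.card:ℝ) * (0.2808 * h * X^4 / t^4 + 0.3 * A^3 * X^15 / t^12 + 4)
       ≤ (A/2) * (0.2808 * h * X^4 / t^4 + 0.3 * A^3 * X^15 / t^12 + 4) := by gcongr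
      _ = 0.01755 * h * X / t + (0.15/4096) * X^3 + t^3 / (4 * X^3) := by
        rw [hA]; field_simp; ring
      _ ≤ _ := by gcongr; norm_num
  have hp2 : (1.872 * (1 + ε) * h * t^8 / X^11) * ∑ a ∈ I, 1 / (a:ℝ)^3 ≤
      1.0272 * (e * (1+ε) * (h / X)) := by
    have hnn : 0 ≤ ∑ a ∈ I, 1 / (a:ℝ)^3 := Finset.sum_nonneg (fun a _ => by positivity)
    have he0 : 0 ≤ e / s0^2 := hnn.trans hcub
    have he1 : 0 ≤ e := by
      have : e = e / s0^2 * s0^2 := by field_simp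
      rw [this]; positivity
    calc (1.872 * (1 + ε) * h * t^8 / X^11) * ∑ a ∈ I, 1 / (a:ℝ)^3
       ≤ (1.872 * (1 + ε) * h * t^8 / X^11) * (e / s0^2) := by gcongr
      _ = (1.872/1.8225) * (e * (1+ε) * (h / X)) := by
        rw [hs0]; field_simp; ring
      _ ≤ _ := by gcongr; norm_num
  have hp0 : (1.093*t^3 - t^3) / A = 0.744 * X^3 := by rw [hA]; field_simp; ring
  rw [hp0] at hgapcard
  have hc' : (T.card:ℝ) ≤ 2 * T'.card := by exact_mod_cast hc
  have e7 : t^3 / (2 * X^3) = 2 * (t^3 / (4 * X^3)) := by field_simp; ring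
  have e8 : 0.0351 * h * X / t = 2 * (0.01755 * h * X / t) := by ring
  rw [e7, e8]
  have hX3 : 0 < X^3 := by positivity
  norm_num at *
  linarith
end SFI

namespace SFI
open Finset

lemma pi_bound (y k : ℝ) (hy : 0 < y) (hk : k < Real.log y) :
    ((Nat.primesLE ⌊y⌋₊).card : ℝ) ≤ 1.3863 * y / (Real.log y - k) + y * Real.exp (-k) := by
  set z := y * Real.exp (-k) with hz
  have hz0 : 0 < z := by positivity
  have hlz : Real.log z = Real.log y - k := by
    rw [hz, Real.log_mul hy.ne' (Real.exp_pos _).ne', Real.log_exp]; ring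
  have hlz0 : 0 < Real.log z := by rw [hlz]; linarith
  have hlog4 : Real.log 4 ≤ 1.3863 := by
    have : Real.log 4 = 2 * Real.log 2 := by
      rw [show (4:ℝ) = 2^2 by norm_num, Real.log_pow]; norm_num
    rw [this]; have := Real.log_two_lt_d9; norm_num at this ⊢; linarith
  have key : ((Nat.primesLE ⌊y⌋₊).card : ℝ) * Real.log z ≤ Real.log 4 * y + z * Real.log z := by
    calc ((Nat.primesLE ⌊y⌋₊).card : ℝ) * Real.log z = ∑ p ∈ Nat.primesLE ⌊y⌋₊, Real.log z := by
          rw [Finset.sum_const, nsmul_eq_mul]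
      _ ≤ ∑ p ∈ Nat.primesLE ⌊y⌋₊, (Real.log p + (if (p:ℝ) ≤ z then Real.log z else 0)) := by
        refine sum_le_sum fun p _ ↦ ?_
        split_ifs with h
        · simp [Real.log_natCast_nonneg]
        have : Real.log z < Real.log p := Real.log_lt_log (by positivity) (not_le.mp h)
        linarith
      _ ≤ _ := by
        have h1 := Chebyshev.theta_le_log4_mul_x hy.le
        rw [Chebyshev.theta_eq_theta_coe_floor, Chebyshev.theta_eq_sum_primesLE_log] at h1
        rw [sum_add_distrib, ← sum_filter]
        simp only [sum_const, nsmul_eq_mul]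
        refine add_le_add h1 ?_
        gcongr
        refine le_trans ?_ <| Nat.floor_le hz0.le
        norm_cast
        rw [show ⌊z⌋₊ = #(Icc 1 ⌊z⌋₊) by simp]
        refine card_le_card fun p hp ↦ ?_
        simp only [mem_filter, mem_Icc, Nat.mem_primesLE] at hp ⊢
        exact ⟨hp.1.2.one_le, Nat.le_floor hp.2⟩
  rw [← hlz, ← sub_le_iff_le_add, le_div_iff₀ hlz0]
  nlinarith

lemma pi_small (y : ℝ) (hy : 6 ≤ y) : ((Nat.primesLE ⌊y⌋₊).card : ℝ) ≤ y / 3 + 3 := by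
  have hN : 6 ≤ ⌊y⌋₊ := Nat.le_floor (by exact_mod_cast hy)
  obtain ⟨n, hn⟩ := Nat.exists_eq_add_of_le hN
  have h1 := Nat.primeCounting'_add_le (a := 6) (k := 7) (by norm_num) (by norm_num) n
  have h7 : Nat.primeCounting' 7 = 3 := by decide
  have ht : Nat.totient 6 = 2 := by decide
  rw [h7, ht] at h1
  have hc : (Nat.primesLE ⌊y⌋₊).card = Nat.primeCounting' (7 + n) := by
    rw [Nat.primesLE_eq_filter_range, Nat.primeCounting', Nat.count_eq_card_filter_range, hn]
    congr 3; omega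
  have h2 : 3 * (Nat.primesLE ⌊y⌋₊).card ≤ ⌊y⌋₊ + 9 := by rw [hc]; omega
  have h3 : (3:ℝ) * (Nat.primesLE ⌊y⌋₊).card ≤ ⌊y⌋₊ + 9 := by exact_mod_cast h2
  have := Nat.floor_le (by linarith : 0 ≤ y)
  linarith

lemma prime_sum_aux (n : ℕ) : 
    ∑ p ∈ (range (2 * (n+50) + 1)).filter Nat.Prime, 1 / (p:ℝ)^2 ≤ 0.456 - 1 / (4 * ((n:ℝ)+50)) := by
  induction n with
  | zero =>
    have : (range (2 * (0+50) + 1)).filter Nat.Prime =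
      {2,3,5,7,11,13,17,19,23,29,31,37,41,43,47,53,59,61,67,71,73,79,83,89,97} := by decide +kernel
    rw [this]
    norm_num
  | succ n ih =>
    have e : 2 * (n + 1 + 50) + 1 = 2 * (n+50) + 1 + 1 + 1 := by ring
    have hnp : ¬ Nat.Prime (2 * (n+50) + 1 + 1) := by
      intro h
      have := h.eq_one_or_self_of_dvd 2 ⟨n+51, by ring⟩
      omega
    rw [e, Finset.range_add_one, Finset.filter_insert, if_neg hnp, Finset.range_add_one, Finset.filter_insert]
    have hst : 1 / ((2 * (n + 50) + 1 : ℕ):ℝ)^2 ≤ 1 / (4 * ((n:ℝ)+50)) - 1 / (4 * ((n:ℝ)+1+50)) := by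
      push_cast
      have : (1:ℝ) / (4 * (n+50)) - 1 / (4 * (n+1+50)) = 1 / (4 * (n+50) * (n+51)) := by
        field_simp; ring
      rw [this]
      apply one_div_le_one_div_of_le (by positivity)
      nlinarith
    have hnn : 0 ≤ 1 / ((2 * (n + 50) + 1 : ℕ):ℝ)^2 := by positivity
    push_cast at hst hnn ⊢
    split_ifs
    · rw [Finset.sum_insert (by simp)]
      push_cast
      linarith
    · linarith

lemma prime_sum (n : ℕ) : ∑ p ∈ Nat.primesLE n, 1 / (p:ℝ)^2 ≤ 0.456 := by
  have h := prime_sum_aux n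
  have h1 : ∑ p ∈ Nat.primesLE n, 1 / (p:ℝ)^2 ≤
      ∑ p ∈ (range (2 * (n+50) + 1)).filter Nat.Prime, 1 / (p:ℝ)^2 := by
    apply Finset.sum_le_sum_of_subset_of_nonneg
    · intro p hp
      rw [Nat.mem_primesLE] at hp
      rw [Finset.mem_filter, Finset.mem_range]
      exact ⟨by omega, hp.2⟩
    · intros; positivity
  have : 0 < 1 / (4 * ((n:ℝ)+50)) := by positivity
  linarith

lemma mult_count (x h : ℝ) (hx : 0 ≤ x) (hh : 0 ≤ h) (q : ℕ) (hq : 0 < q) :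
    (((Finset.Ioc ⌊x⌋₊ ⌊x+h⌋₊).filter (fun n => q ∣ n)).card : ℝ) ≤ h / q + 1 := by
  set A := (Finset.Ioc ⌊x⌋₊ ⌊x+h⌋₊).filter (fun n => q ∣ n) with hA
  have hq0 : (0:ℝ) < q := by exact_mod_cast hq
  have hinj : Set.InjOn (fun n : ℕ => ((n / q : ℕ) : ℤ)) A := by
    intro a ha b hb hab
    have ha' := (Finset.mem_filter.1 ha).2
    have hb' := (Finset.mem_filter.1 hb).2
    have : a / q = b / q := by
      have h9 : ((a / q : ℕ) : ℤ) = ((b / q : ℕ) : ℤ) := hab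
      exact_mod_cast h9
    rw [← Nat.div_mul_cancel ha', ← Nat.div_mul_cancel hb', this]
  rw [← Finset.card_image_of_injOn hinj]
  refine (card_int_le _ (x / q) ((x+h)/q) ?_ (by gcongr; linarith)).trans (by rw [add_div]; linarith)
  intro u hu
  obtain ⟨n, hn, rfl⟩ := Finset.mem_image.1 hu
  obtain ⟨hn1, k, rfl⟩ := Finset.mem_filter.1 hn
  rw [Finset.mem_Ioc, Nat.floor_lt hx, Nat.le_floor_iff (by linarith)] at hn1
  push_cast at hn1
  rw [Nat.mul_div_cancel_left _ hq]
  push_cast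
  constructor
  · rw [div_le_iff₀ hq0]; linarith [hn1.1]
  · rw [le_div_iff₀ hq0]; linarith [hn1.2]

lemma sieve (x h P : ℝ) (hx : 0 ≤ x) (hh : 0 ≤ h) (hP : 0 ≤ P) (hP2 : h ≤ P^2)
    (hno : ∀ n : ℕ, x < n → (n:ℝ) ≤ x + h → ¬ Squarefree n) :
    ∃ S : Finset ℕ, (∀ p ∈ S, p.Prime ∧ P < p ∧ Good x h p) ∧
      h - 1 ≤ 0.456 * h + (Nat.primesLE ⌊P⌋₊).card + S.card := by
  classical
  set J := Finset.Ioc ⌊x⌋₊ ⌊x+h⌋₊ with hJ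
  have hJm : ∀ n ∈ J, x < n ∧ (n:ℝ) ≤ x + h := by
    intro n hn
    rwa [hJ, Finset.mem_Ioc, Nat.floor_lt hx, Nat.le_floor_iff (by linarith)] at hn
  have hex : ∀ n ∈ J, ∃ p : ℕ, p.Prime ∧ p^2 ∣ n := by
    intro n hn
    have h1 := hno n (hJm n hn).1 (hJm n hn).2
    rw [Nat.squarefree_iff_prime_squarefree] at h1
    push Not at h1
    obtain ⟨p, hp, hd⟩ := h1
    exact ⟨p, hp, by rw [sq]; exact hd⟩
  choose! f hf1 hf2 using hex
  set J2 := J.filter (fun n => P < f n) with hJ2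
  have hinj : Set.InjOn f J2 := by
    have key : ∀ a ∈ J2, ∀ b ∈ J2, f a = f b → ¬ a < b := by
      intro a ha b hb hab hlt
      have ha' := Finset.mem_filter.1 ha
      have hb' := Finset.mem_filter.1 hb
      obtain ⟨k, hk⟩ := hf2 a ha'.1
      obtain ⟨l, hl⟩ := hf2 b hb'.1
      rw [← hab] at hl
      have hkl : k + 1 ≤ l := by
        by_contra hc
        have : l ≤ k := by omega
        have : f a ^2 * l ≤ f a ^2 * k := Nat.mul_le_mul_left _ this
        omega
      have h1 := hJm a ha'.1
      have h2 := hJm b hb'.1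
      have h3 : a + f a ^ 2 ≤ b := by
        calc a + f a^2 = f a ^2 * (k+1) := by rw [mul_add, ← hk, mul_one]
          _ ≤ f a ^2 * l := Nat.mul_le_mul_left _ hkl
          _ = b := hl.symm
      have h4 : (a:ℝ) + (f a:ℝ)^2 ≤ b := by exact_mod_cast h3
      have h5 : P^2 < (f a:ℝ)^2 := by
        have := ha'.2
        gcongr
      linarith [h1.1, h2.2]
    intro a ha b hb hab
    rcases lt_trichotomy a b with h | h | h
    · exact absurd h (key a ha b hb hab)
    · exact h
    · exact absurd h (key b hb a ha hab.symm)
  refine ⟨J2.image f, ?_, ?_⟩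
  · intro p hp
    obtain ⟨n, hn, rfl⟩ := Finset.mem_image.1 hp
    have hn' := Finset.mem_filter.1 hn
    refine ⟨hf1 n hn'.1, hn'.2, ?_⟩
    obtain ⟨k, hk⟩ := hf2 n hn'.1
    have h1 := hJm n hn'.1
    have : (n:ℝ) = (k:ℝ) * (f n:ℝ)^2 := by
      calc (n:ℝ) = ((f n ^2 * k : ℕ):ℝ) := by rw [← hk]
        _ = _ := by push_cast; ring
    rw [this] at h1
    exact ⟨k, h1.1, h1.2⟩
  · rw [Finset.card_image_of_injOn hinj]
    have hcJ : h - 1 ≤ (J.card:ℝ) := by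
      rw [hJ, Nat.card_Ioc]
      have hle : ⌊x⌋₊ ≤ ⌊x+h⌋₊ := Nat.floor_le_floor (by linarith)
      rw [Nat.cast_sub hle]
      have := Nat.floor_le hx
      have := Nat.lt_floor_add_one (x+h)
      linarith
    have hsub : J ⊆ (Nat.primesLE ⌊P⌋₊).biUnion (fun p => J.filter (fun n => p^2 ∣ n)) ∪ J2 := by
      intro n hn
      rw [Finset.mem_union]
      by_cases hc : P < f n
      · right; exact Finset.mem_filter.2 ⟨hn, hc⟩
      · left
        rw [Finset.mem_biUnion]
        refine ⟨f n, ?_, Finset.mem_filter.2 ⟨hn, hf2 n hn⟩⟩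
        rw [Nat.mem_primesLE]
        exact ⟨Nat.le_floor (not_lt.1 hc), hf1 n hn⟩
    have h1 : (J.card : ℝ) ≤ ∑ p ∈ Nat.primesLE ⌊P⌋₊, ((J.filter (fun n => p^2 ∣ n)).card : ℝ) + J2.card := by
      have := (Finset.card_le_card hsub).trans (Finset.card_union_le _ _)
      have h2 := this.trans (Nat.add_le_add_right Finset.card_biUnion_le _)
      exact_mod_cast h2
    have h2 : ∑ p ∈ Nat.primesLE ⌊P⌋₊, ((J.filter (fun n => p^2 ∣ n)).card : ℝ) ≤
        ∑ p ∈ Nat.primesLE ⌊P⌋₊, (h * (1 / (p:ℝ)^2) + 1) := by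
      apply Finset.sum_le_sum
      intro p hp
      have := mult_count x h hx hh (p^2) (pow_pos (Nat.mem_primesLE.1 hp).2.pos 2)
      push_cast at this
      rw [mul_one_div]
      exact this
    rw [Finset.sum_add_distrib, ← Finset.mul_sum, Finset.sum_const, nsmul_eq_mul, mul_one] at h2
    have h3 := mul_le_mul_of_nonneg_left (prime_sum ⌊P⌋₊) hh
    linarith
end SFI

namespace SFI
open Finset

lemma split_blocks (S : Finset ℕ) (t : ℕ → ℝ) (h0 : ∀ u ∈ S, t 0 ≤ (u:ℝ)) (K : ℕ) :
    (S.card : ℝ) ≤ ∑ j ∈ range K, ((S.filter (fun u : ℕ => t j ≤ (u:ℝ) ∧ (u:ℝ) < t (j+1))).card : ℝ)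
      + ((S.filter (fun u : ℕ => t K ≤ (u:ℝ))).card : ℝ) := by
  classical
  induction K with
  | zero =>
    have : S.filter (fun u : ℕ => t 0 ≤ (u:ℝ)) = S := Finset.filter_true_of_mem h0
    simp [this]
  | succ K ih =>
    rw [Finset.sum_range_succ]
    have hsub : S.filter (fun u : ℕ => t K ≤ (u:ℝ)) ⊆
        S.filter (fun u : ℕ => t K ≤ (u:ℝ) ∧ (u:ℝ) < t (K+1)) ∪ S.filter (fun u : ℕ => t (K+1) ≤ (u:ℝ)) := by
      intro u hu
      rw [Finset.mem_filter] at hu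
      rw [Finset.mem_union, Finset.mem_filter, Finset.mem_filter]
      rcases lt_or_ge (u:ℝ) (t (K+1)) with h | h
      · left; exact ⟨hu.1, hu.2, h⟩
      · right; exact ⟨hu.1, h⟩
    have h1 := (Finset.card_le_card hsub).trans (Finset.card_union_le _ _)
    have h2 : ((S.filter (fun u : ℕ => t K ≤ (u:ℝ))).card : ℝ) ≤
      (S.filter (fun u : ℕ => t K ≤ (u:ℝ) ∧ (u:ℝ) < t (K+1))).card + (S.filter (fun u : ℕ => t (K+1) ≤ (u:ℝ))).card := by
      exact_mod_cast h1
    linarith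

lemma geom_inv (r : ℝ) (hr : 1 < r) (n : ℕ) : ∑ j ∈ range n, 1 / r^j ≤ r / (r - 1) := by
  have h : ∑ j ∈ range n, 1 / r^j = r / (r-1) * (1 - 1 / r^n) := by
    have : r - 1 ≠ 0 := by linarith
    have : r ≠ 0 := by linarith
    induction n with
    | zero => simp
    | succ n ih => rw [Finset.sum_range_succ, ih]; field_simp; ring
  rw [h]
  have h1 : 0 < r / (r-1) := div_pos (by linarith) (by linarith)
  have h2 : 0 < 1 / r^n := by positivity
  nlinarith

lemma geom_up (r : ℝ) (hr : 1 < r) (n : ℕ) : ∑ j ∈ range (n+1), r^j ≤ r / (r - 1) * r^n := by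
  have h : ∑ j ∈ range (n+1), r^j = (r^(n+1) - 1) / (r-1) := by
    rw [geom_sum_eq (by linarith)]
  rw [h, div_mul_eq_mul_div]
  have : 0 < r - 1 := by linarith
  gcongr
  rw [pow_succ]; linarith

/-- parameters -/
structure Par (X η : ℝ) : Prop where
  X18 : 18 ≤ X^2
  X1 : 1 ≤ X
  e33 : 33 ≤ η
  eX : η ≤ 2 * X^2

lemma Par.blk {X η : ℝ} (p : Par X η) (t : ℝ) (ht : 0 < t) (h2 : 2 * (η * X^3) ≤ t^3)
    (hR : (η * X^3) * t^6 ≤ 33 * X^15) (T : Finset ℕ)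
    (hT : ∀ u ∈ T, t^3 ≤ (u:ℝ) ∧ (u:ℝ) < (t*1.03)^3 ∧ Odd u ∧ Good (X^15) (η * X^3) u) :
    Blk X (η * X^3) t T := by
  obtain ⟨X18, X1, e33, eX⟩ := p
  have X0 : 0 < X := by linarith
  have htX : X ≤ t := by
    by_contra hc
    push Not at hc
    have : t^3 < X^3 := by gcongr
    nlinarith [pow_pos X0 3]
  refine ⟨X1, by positivity, ht, ?_, ?_, ?_⟩
  · intro u hu
    obtain ⟨a, b, c, d⟩ := hT u hu
    refine ⟨a, ?_, c, d⟩
    have : (t*1.03)^3 = 1.092727 * t^3 := by ring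
    rw [this] at b
    have := pow_pos ht 3
    norm_num at b ⊢
    linarith
  · have h1 : X^2 ≤ t^2 := by gcongr
    calc 9 * (η * X^3) ≤ 9 * ((2 * X^2) * X^3) := by gcongr
      _ = 18 * X^5 := by ring
      _ ≤ X^2 * X^5 := by gcongr
      _ ≤ t^2 * X^5 := by gcongr
  · set h := η * X^3 with hh
    have hh5 : h ≤ 2 * X^5 := by
      calc h ≤ (2*X^2)*X^3 := by rw [hh]; gcongr
        _ = _ := by ring
    have hX3 : 1 ≤ X^3 := one_le_pow₀ X1
    have hh1 : 33 ≤ h := by rw [hh]; nlinarith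
    rcases lt_or_ge (t^9) (8 * X^15) with h9 | h9
    · left
      have h3 : t^3 < 2 * X^5 := by
        by_contra hc
        push Not at hc
        have : (2*X^5)^3 ≤ (t^3)^3 := by gcongr
        ring_nf at this h9
        linarith
      have h6 : t^6 < 4 * X^10 := by
        have : (t^3)^2 < (2*X^5)^2 := by gcongr
        ring_nf at this ⊢
        linarith
      calc h * 1.4272 * t^6 ≤ (2*X^5) * 1.4272 * (4 * X^10) := by gcongr
        _ = 11.4176 * X^15 := by ring
        _ < 12 * X^15 := by gcongr; norm_num
    · right
      refine ⟨h9, ?_, ?_, ?_⟩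
      · have : t^6 = t^3 * t^3 := by ring
        rw [this]; nlinarith
      · have hsq : (h * (1.093*t^3))^2 ≤ (2 * X^15)^2 := by
          have e : (h * (1.093*t^3))^2 = 1.194649 * h * (h * t^6) := by ring
          rw [e]
          have hX10 : 18^5 ≤ X^10 := by
            have : (18:ℝ)^5 ≤ (X^2)^5 := by gcongr
            rw [← pow_mul] at this; exact this
          calc 1.194649 * h * (h * t^6) ≤ 1.194649 * (2 * X^5) * (33 * X^15) := by gcongr
            _ ≤ (80 * X^5) * X^15 := by
              have : 0 < X^5 * X^15 := by positivity
              norm_num; nlinarith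
            _ ≤ (X^10 * X^5) * X^15 := by gcongr; norm_num at hX10; linarith
            _ ≤ _ := by
              have : 0 < X^30 := by positivity
              ring_nf; linarith
        exact le_of_sq_le_sq hsq (by positivity)
      · have : h * 1.4272 * t^6 = 1.4272 * (h * t^6) := by ring
        rw [this]
        have : 0 < X^15 := by positivity
        norm_num
        linarith

lemma exists_first (p : ℕ → Prop) (h : ∃ n, p n) : ∃ n, p n ∧ ∀ m < n, ¬ p m := by
  classical
  exact ⟨Nat.find h, Nat.find_spec h, fun m hm => Nat.find_min h hm⟩

lemma exists_pow_gt (t C : ℝ) (ht : 0 < t) : ∃ n : ℕ, C < t * 1.03^n := by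
  obtain ⟨n, hn⟩ := pow_unbounded_of_one_lt (C / t) (by norm_num : (1:ℝ) < 1.03)
  exact ⟨n, by rw [div_lt_iff₀ ht] at hn; linarith⟩

lemma tail2 {X η : ℝ} (p : Par X η) (t : ℝ) (ht : 0 < t) (h2 : 2 * (η * X^3) ≤ t^3)
    (hK : 33 * X^15 < (η * X^3) * t^6) (S : Finset ℕ)
    (hS : ∀ u ∈ S, t^3 ≤ (u:ℝ) ∧ Good (X^15) (η * X^3) u) :
    (S.card : ℝ) ≤ 0.0304 * (η * X^3) := by
  obtain ⟨X18, X1, e33, eX⟩ := p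
  have X0 : 0 < X := by linarith
  have e0 : 0 < η := by linarith
  set h := η * X^3 with hh
  have h0 : 0 < h := by positivity
  have := two_pt (X^15) h (t^3) (by positivity) h0.le (by positivity) (by linarith) S hS
  refine this.trans ?_
  rw [div_le_iff₀ (by positivity)]
  have e : 0.0304 * h * (t^3)^2 = 0.0304 * (h * t^6) := by ring
  rw [e]
  have hh5 : h ≤ 2 * X^5 := by
    calc h ≤ (2*X^2)*X^3 := by rw [hh]; gcongr
      _ = _ := by ring
  have hX10 : 18^5 ≤ X^10 := by
    have : (18:ℝ)^5 ≤ (X^2)^5 := by gcongr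
    rw [← pow_mul] at this; exact this
  have h15 : X^15 = X^10 * X^5 := by ring
  have h16 : 18^5 * X^5 ≤ X^15 := by rw [h15]; gcongr
  have := pow_pos X0 5
  norm_num at h16 ⊢
  linarith

lemma tailB {X η : ℝ} (p : Par X η) (t : ℝ) (ht : 0 < t) (h2 : 2 * (η * X^3) ≤ t^3) (S : Finset ℕ)
    (hS : ∀ u ∈ S, t^3 ≤ (u:ℝ) ∧ Odd u ∧ Good (X^15) (η * X^3) u) :
    (S.card : ℝ) ≤ 0.0304 * (η * X^3) + 4.7307 * X^5 / t + 68 * X + 2 := by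
  have p' := p
  obtain ⟨X18, X1, e33, eX⟩ := p
  have X0 : 0 < X := by linarith
  have e0 : 0 < η := by linarith
  set h := η * X^3 with hh
  have h0 : 0 < h := by positivity
  have htX : X ≤ t := by
    by_contra hc
    push Not at hc
    have : t^3 < X^3 := by gcongr
    nlinarith [pow_pos X0 3]
  have t1 : 1 ≤ t := by linarith
  have hex : ∃ n : ℕ, 33 * X^15 < h * (t*1.03^n)^6 := by
    obtain ⟨n, hn⟩ := exists_pow_gt t (33 * X^15/h + 1) ht
    refine ⟨n, ?_⟩
    have h1 : 1 ≤ t * 1.03^n := by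
      have : (0:ℝ) ≤ 33 * X^15 / h := by positivity
      linarith
    have h3 : t * 1.03^n ≤ (t*1.03^n)^6 := le_self_pow₀ h1 (by norm_num)
    have h4 : 33 * X^15 / h < (t*1.03^n)^6 := by linarith
    rw [div_lt_iff₀ h0] at h4
    linarith
  obtain ⟨K, hK, hKm⟩ := exists_first _ hex
  have hsp := split_blocks S (fun j => (t*1.03^j)^3) (by simpa using fun u hu => (hS u hu).1) K
  have hblk : ∀ j ∈ range K, ((S.filter (fun u : ℕ => (t*1.03^j)^3 ≤ (u:ℝ) ∧ (u:ℝ) < (t*1.03^(j+1))^3)).card : ℝ)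
      ≤ (0.13778 * X^5 / t) * (1 / 1.03^j) + 2 := by
    intro j hj
    have hj' := hKm j (Finset.mem_range.1 hj)
    push Not at hj'
    have h1j : (1:ℝ) ≤ 1.03^j := one_le_pow₀ (by norm_num)
    have hB := p'.blk (t*1.03^j) (by positivity) (h2.trans (by gcongr; nlinarith)) hj'
      (S.filter (fun u : ℕ => (t*1.03^j)^3 ≤ (u:ℝ) ∧ (u:ℝ) < (t*1.03^(j+1))^3)) (by
        intro u hu
        rw [Finset.mem_filter] at hu
        refine ⟨hu.2.1, ?_, (hS u hu.1).2⟩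
        have := hu.2.2
        rw [pow_succ (1.03:ℝ) j, ← mul_assoc] at this
        exact this)
    refine hB.boundB.trans (le_of_eq ?_)
    field_simp
  have hsum := Finset.sum_le_sum hblk
  rw [Finset.sum_add_distrib, ← Finset.mul_sum, Finset.sum_const, nsmul_eq_mul, Finset.card_range] at hsum
  have hgeo := geom_inv 1.03 (by norm_num) K
  have hA : (0.13778 * X^5 / t) * ∑ j ∈ range K, (1:ℝ) / 1.03^j ≤ 4.7307 * X^5 / t := by
    calc _ ≤ (0.13778 * X^5 / t) * (1.03 / (1.03 - 1)) := by gcongr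
      _ = (0.13778 * 103/3) * (X^5/t) := by ring
      _ ≤ 4.7307 * (X^5/t) := by gcongr; norm_num
      _ = _ := by ring
  have hKb : (K:ℝ) * 2 ≤ 68 * X + 2 := by
    rcases Nat.eq_zero_or_pos K with hK0 | hK0
    · rw [hK0]; simp; linarith
    · obtain ⟨k, rfl⟩ : ∃ k, K = k + 1 := ⟨K - 1, by omega⟩
      have := hKm k (by omega)
      push Not at this
      have h6 : (1.03:ℝ)^k ≤ X := by
        by_contra hc
        push Not at hc
        have h1 : (X*X)^6 < (t*1.03^k)^6 := by
          apply pow_lt_pow_left₀ _ (by positivity) (by norm_num)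
          calc X * X < X * 1.03^k := by gcongr
            _ ≤ t * 1.03^k := by gcongr
        have h3 : 33 * X^3 ≤ h := by rw [hh]; gcongr
        have h4 : (33 * X^3) * (X*X)^6 < h * (t*1.03^k)^6 := by
          calc _ ≤ h * (X*X)^6 := by gcongr
            _ < _ := by gcongr
        have : (33 * X^3) * (X*X)^6 = 33 * X^15 := by ring
        linarith
      have hb := one_add_mul_le_pow (by norm_num : (-2:ℝ) ≤ 0.03) k
      norm_num at hb h6
      push_cast
      linarith
  have h1K : (1:ℝ) ≤ 1.03^K := one_le_pow₀ (by norm_num)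
  have hbig := tail2 p' (t*1.03^K) (by positivity) (h2.trans (by gcongr; nlinarith)) hK
    (S.filter (fun u : ℕ => (t*1.03^K)^3 ≤ (u:ℝ))) (by
        intro u hu
        rw [Finset.mem_filter] at hu
        exact ⟨hu.2, (hS u hu.1).2.2⟩)
  linarith

lemma countD {X η : ℝ} (p : Par X η) (t : ℝ) (ht : 0 < t) (h2 : 2 * (η * X^3) = t^3) (S : Finset ℕ)
    (hS : ∀ u ∈ S, t^3 ≤ (u:ℝ) ∧ Odd u ∧ Good (X^15) (η * X^3) u) (h13 : 13 * η ≤ X^3)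
    (e : ℝ) (he0 : 0 ≤ e) (he : ∀ I : Finset ℕ, ∀ t' : ℝ, t ≤ t' → (∀ a ∈ I, Even a ∧ 0 < a ∧ 1.35 * t'^4 / X^5 ≤ a) →
      ∑ a ∈ I, 1 / (a:ℝ) ^ 3 ≤ e / (1.35 * t'^4 / X^5)^2) :
    ∃ J : ℕ, (J = 0 ∨ t * 1.03^(J-1) ≤ X^2 / 10.8) ∧
    (S.card : ℝ) ≤ 0.0304 * (η * X^3) + 51.1 * X^3 + 68 * X + 2 + J * (2 + 1.48808 * X^3) + 0.0047 * X^3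
      + 1.2052 * (η * X^3) * X / t + 2.0544 * e * (J + 11.785) * (η * X^3 / X) := by
  have p' := p
  obtain ⟨X18, X1, e33, eX⟩ := p
  have X0 : 0 < X := by linarith
  have e0 : 0 < η := by linarith
  set h := η * X^3 with hh
  have h0 : 0 < h := by positivity
  have htX : X ≤ t := by
    by_contra hc
    push Not at hc
    have : t^3 < X^3 := by gcongr
    nlinarith [pow_pos X0 3]
  obtain ⟨J, hJ, hJm⟩ := exists_first (fun n => X^2/10.8 < t * 1.03^n ∨ 33 * X^15 < h * (t*1.03^n)^6)
    (by
      obtain ⟨n, hn⟩ := exists_pow_gt t (X^2/10.8) ht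
      exact ⟨n, Or.inl hn⟩)
  have h1J : ∀ j : ℕ, (1:ℝ) ≤ 1.03^j := fun j => one_le_pow₀ (by norm_num)
  have hJm1 : ∀ j < J, t * 1.03^j ≤ X^2/10.8 := fun j hj => not_lt.1 (not_or.1 (hJm j hj)).1
  have hJm2 : ∀ j < J, h * (t*1.03^j)^6 ≤ 33 * X^15 := fun j hj => not_lt.1 (not_or.1 (hJm j hj)).2
  refine ⟨J, ?_, ?_⟩
  · rcases Nat.eq_zero_or_pos J with h | h
    · left; exact h
    · right; exact hJm1 (J-1) (by omega)
  have hsp := split_blocks S (fun j => (t*1.03^j)^3) (by simpa using fun u hu => (hS u hu).1) J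
  have htail : ((S.filter (fun u : ℕ => (t*1.03^J)^3 ≤ (u:ℝ))).card : ℝ) ≤
      0.0304 * h + 51.1 * X^3 + 68 * X + 2 := by
    have h2' : 2 * h ≤ (t*1.03^J)^3 := by rw [h2]; gcongr; nlinarith [h1J J]
    rcases hJ with hJ | hJ
    · have htail := tailB p' (t*1.03^J) (by positivity) h2'
        (S.filter (fun u : ℕ => (t*1.03^J)^3 ≤ (u:ℝ))) (by
          intro u hu
          rw [Finset.mem_filter] at hu
          exact ⟨hu.2, (hS u hu.1).2⟩)
      rw [← hh] at htail
      have ht2 : 4.7307 * X^5 / (t*1.03^J) ≤ 51.1 * X^3 := by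
        rw [div_le_iff₀ (by positivity)]
        have : 51.1 * X^3 * (X^2/10.8) ≤ 51.1 * X^3 * (t * 1.03^J) := by gcongr
        have e1 : 51.1 * X^3 * (X^2/10.8) = (51.1/10.8) * X^5 := by ring
        rw [e1] at this
        have := pow_pos X0 5
        norm_num at *
        linarith
      linarith
    · have htail := tail2 p' (t*1.03^J) (by positivity) h2' hJ
        (S.filter (fun u : ℕ => (t*1.03^J)^3 ≤ (u:ℝ))) (by
          intro u hu
          rw [Finset.mem_filter] at hu
          exact ⟨hu.2, (hS u hu.1).2.2⟩)
      have : 0 < X^3 := by positivity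
      rw [← hh] at htail
      linarith
  have hblk : ∀ j ∈ range J, ((S.filter (fun u : ℕ => (t*1.03^j)^3 ≤ (u:ℝ) ∧ (u:ℝ) < (t*1.03^(j+1))^3)).card : ℝ)
      ≤ ((2 + 1.48808 * X^3) + 2.0544 * e * (h/X)) + (t^3 / (2*X^3)) * (1.03^3)^j +
        (0.0351 * h * X / t) * (1 / 1.03^j) + (2.0544 * e * (h/X)) * (1 / (1.03^3)^j) := by
    intro j hj
    have h1j := h1J j
    have htj : t ≤ t * 1.03^j := by nlinarith
    have hB := p'.blk (t*1.03^j) (by positivity) (by rw [← hh, h2]; gcongr) (by rw [← hh]; exact hJm2 j (Finset.mem_range.1 hj))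
      (S.filter (fun u : ℕ => (t*1.03^j)^3 ≤ (u:ℝ) ∧ (u:ℝ) < (t*1.03^(j+1))^3)) (by
        intro u hu
        rw [Finset.mem_filter] at hu
        refine ⟨hu.2.1, ?_, (hS u hu.1).2⟩
        have := hu.2.2
        rw [pow_succ (1.03:ℝ) j, ← mul_assoc] at this
        exact this)
    rw [← hh] at hB
    have hD := hB.boundD (e := e) (by rw [h2]; gcongr) (by
      have hXt : X ≤ t * 1.03^j := by linarith
      calc 13 * h = (13 * η) * X^3 := by rw [hh]; ring
        _ ≤ X^3 * X^3 := by gcongr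
        _ = X^2 * X^4 := by ring
        _ ≤ (t*1.03^j)^2 * X^4 := by gcongr) (fun I hI => he I _ htj hI)
    refine hD.trans (le_of_eq ?_)
    have e2 : 2 * h / (t*1.03^j)^3 = 1 / (1.03^3)^j := by
      rw [h2, mul_pow, ← pow_mul, ← pow_mul, mul_comm j 3]; field_simp
    have e3 : (t*1.03^j)^3 / (2 * X^3) = (t^3 / (2*X^3)) * (1.03^3)^j := by
      rw [mul_pow, ← pow_mul, ← pow_mul, mul_comm j 3]; ring
    have e4 : 0.0351 * h * X / (t * 1.03^j) = (0.0351 * h * X / t) * (1 / 1.03^j) := by field_simp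
    rw [e2, e3, e4]; ring
  have hsum := Finset.sum_le_sum hblk
  rw [Finset.sum_add_distrib, Finset.sum_add_distrib, Finset.sum_add_distrib, ← Finset.mul_sum,
    ← Finset.mul_sum, ← Finset.mul_sum, Finset.sum_const, nsmul_eq_mul, Finset.card_range] at hsum
  have g1 : (0.0351 * h * X / t) * ∑ j ∈ range J, (1:ℝ) / 1.03^j ≤ 1.2052 * h * X / t := by
    calc _ ≤ (0.0351 * h * X / t) * (1.03 / (1.03 - 1)) := by
          gcongr; exact geom_inv 1.03 (by norm_num) J
      _ = (0.0351 * 103/3) * (h*X/t) := by ring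
      _ ≤ 1.2052 * (h*X/t) := by gcongr; norm_num
      _ = _ := by ring
  have g2 : (2.0544 * e * (h/X)) * ∑ j ∈ range J, (1:ℝ) / (1.03^3)^j ≤ (2.0544 * e * (h/X)) * 11.785 := by
    gcongr
    refine (geom_inv (1.03^3) (by norm_num) J).trans (by norm_num)
  have g3 : (t^3 / (2*X^3)) * ∑ j ∈ range J, ((1.03:ℝ)^3)^j ≤ 0.0047 * X^3 := by
    rcases Nat.eq_zero_or_pos J with hJ0 | hJ0
    · rw [hJ0]; simp; positivity
    · obtain ⟨k, rfl⟩ : ∃ k, J = k + 1 := ⟨J - 1, by omega⟩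
      have hk := hJm1 k (by omega)
      calc (t^3 / (2*X^3)) * ∑ j ∈ range (k+1), ((1.03:ℝ)^3)^j
          ≤ (t^3 / (2*X^3)) * ((1.03^3) / (1.03^3 - 1) * (1.03^3)^k) := by
            gcongr; exact geom_up (1.03^3) (by norm_num) k
        _ = ((1.03^3) / (1.03^3 - 1) / 2 / X^3) * (t*1.03^k)^3 := by
            rw [mul_pow, ← pow_mul, ← pow_mul, mul_comm k 3]; field_simp
        _ ≤ ((1.03^3) / (1.03^3 - 1) / 2 / X^3) * (X^2/10.8)^3 := by gcongr
        _ = ((1.03^3) / (1.03^3 - 1) / 2 / 10.8^3) * X^3 := by field_simp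
        _ ≤ _ := by gcongr; norm_num
  have e9 : 2.0544 * e * (J + 11.785) * (h / X) = J * (2.0544 * e * (h/X)) + (2.0544 * e * (h/X)) * 11.785 := by ring
  rw [e9]
  linarith
end SFI


namespace SFI
open Finset

lemma exp_le_of (n d : ℕ) (c : ℝ) (hd : d ≠ 0) (hc : 0 ≤ c)
    (h : (2.7182818286 : ℝ) ^ n ≤ c ^ d) : Real.exp ((n : ℝ) / d) ≤ c := by
  have h1 : Real.exp ((n : ℝ) / d) ^ d = Real.exp 1 ^ n := by
    rw [← Real.exp_nat_mul, ← Real.exp_nat_mul]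
    congr 1
    have : (d : ℝ) ≠ 0 := by exact_mod_cast hd
    field_simp
  have h2 : Real.exp 1 ^ n ≤ (2.7182818286 : ℝ) ^ n :=
    pow_le_pow_left₀ (Real.exp_pos 1).le Real.exp_one_lt_d9.le n
  exact le_of_pow_le_pow_left₀ hd hc (by rw [h1]; exact h2.trans h)

lemma le_exp_of (n d : ℕ) (c : ℝ) (hd : d ≠ 0)
    (h : c ^ d ≤ (2.7182818283 : ℝ) ^ n) : c ≤ Real.exp ((n : ℝ) / d) := by
  have h1 : Real.exp ((n : ℝ) / d) ^ d = Real.exp 1 ^ n := by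
    rw [← Real.exp_nat_mul, ← Real.exp_nat_mul]
    congr 1
    have : (d : ℝ) ≠ 0 := by exact_mod_cast hd
    field_simp
  have h2 : (2.7182818283 : ℝ) ^ n ≤ Real.exp 1 ^ n :=
    pow_le_pow_left₀ (by norm_num) Real.exp_one_gt_d9.le n
  exact le_of_pow_le_pow_left₀ hd (Real.exp_pos _).le (by rw [h1]; exact h.trans h2)

lemma le_log_of (n d : ℕ) (c : ℝ) (hd : d ≠ 0) (hc : 0 < c)
    (h : (2.7182818286 : ℝ) ^ n ≤ c ^ d) : (n : ℝ) / d ≤ Real.log c := by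
  rw [Real.le_log_iff_exp_le hc]
  exact exp_le_of n d c hd hc.le h

/-- prime count below twice h -/
lemma pi2h (h l : ℝ) (h0 : 0 < h) (hl : 6 < l) (hlog : l ≤ Real.log (2 * h)) :
    ((Nat.primesLE ⌊2 * h⌋₊).card : ℝ) ≤ (2.7726 / (l - 6) + 0.005) * h := by
  have h1 := pi_bound (2 * h) 6 (by linarith) (by linarith)
  have e6 : Real.exp (-6) ≤ 0.0025 := by
    rw [Real.exp_neg]
    have := le_exp_of 6 1 400 (by norm_num) (by norm_num)
    norm_num at this
    rw [inv_le_comm₀ (Real.exp_pos _) (by norm_num)]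
    norm_num
    exact this
  have h2 : 1.3863 * (2 * h) / (Real.log (2 * h) - 6) ≤ 1.3863 * (2 * h) / (l - 6) := by
    apply div_le_div_of_nonneg_left (by linarith) (by linarith) (by linarith)
  have h3 : 1.3863 * (2 * h) / (l - 6) = 2.7726 / (l - 6) * h := by ring
  nlinarith

lemma pi2h5 (h l : ℝ) (h0 : 0 < h) (hl : 5 < l) (hlog : l ≤ Real.log (2 * h)) :
    ((Nat.primesLE ⌊2 * h⌋₊).card : ℝ) ≤ (2.7726 / (l - 5) + 0.0136) * h := by
  have h1 := pi_bound (2 * h) 5 (by linarith) (by linarith)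
  have e6 : Real.exp (-5) ≤ 0.0068 := by
    rw [Real.exp_neg]
    have := le_exp_of 5 1 (1/0.0068) (by norm_num) (by norm_num)
    rw [inv_le_comm₀ (Real.exp_pos _) (by norm_num)]
    norm_num at this ⊢
    exact this
  have h2 : 1.3863 * (2 * h) / (Real.log (2 * h) - 5) ≤ 1.3863 * (2 * h) / (l - 5) := by
    apply div_le_div_of_nonneg_left (by linarith) (by linarith) (by linarith)
  have h3 : 1.3863 * (2 * h) / (l - 5) = 2.7726 / (l - 5) * h := by ring
  nlinarith

/-- standing parametrisation -/
structure Set0 (L X η h : ℝ) : Prop where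
  hX : X = Real.exp (L / 15)
  hη : η = 11 * L
  hh : h = η * X ^ 3

lemma Set0.log2h {L X η h : ℝ} (q : Set0 L X η h) (a l : ℝ) (ha : 0 < a) (haL : a ≤ L)
    (hl : l ≤ Real.log (22 * a)) : l + a / 5 ≤ Real.log (2 * h) := by
  have e : 2 * h = (22 * L) * X ^ 3 := by rw [q.hh, q.hη]; ring
  have hX : 0 < X := by rw [q.hX]; exact Real.exp_pos _
  rw [e, Real.log_mul (by linarith) (by positivity), Real.log_pow, q.hX, Real.log_exp]
  have := Real.log_le_log (by linarith : 0 < 22 * a) (by linarith : 22 * a ≤ 22 * L)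
  push_cast
  linarith

lemma Set0.Xlow {L X η h : ℝ} (q : Set0 L X η h) (a A : ℝ) (ha : 15 ≤ a) (haL : a ≤ L) (hA : 0 ≤ A)
    (hAe : A ≤ Real.exp (a / 15)) : A * (L / a) ≤ X := by
  rw [q.hX]
  have e : Real.exp (L / 15) = Real.exp (a / 15) * Real.exp ((L - a) / 15) := by
    rw [← Real.exp_add]; congr 1; ring
  rw [e]
  have h1 : L / a ≤ 1 + (L - a) / 15 := by
    have : L / a = 1 + (L - a) / a := by field_simp; ring
    rw [this]
    have : (L - a) / a ≤ (L - a) / 15 := by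
      apply div_le_div_of_nonneg_left (by linarith) (by norm_num) ha
    linarith
  have h2 := Real.add_one_le_exp ((L - a) / 15)
  have h4 : 0 ≤ L / a := div_nonneg (by linarith) (by linarith)
  apply mul_le_mul hAe (by linarith) h4 (Real.exp_pos _).le

lemma Set0.Xup {L X η h : ℝ} (q : Set0 L X η h) (b B : ℝ) (hb : L ≤ b)
    (hB : Real.exp (b / 15) ≤ B) : X ≤ B := by
  rw [q.hX]
  exact (Real.exp_le_exp.2 (by linarith)).trans hB

lemma Set0.x15 {L X η h : ℝ} (q : Set0 L X η h) : X ^ 15 = Real.exp L := by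
  rw [q.hX, ← Real.exp_nat_mul]; congr 1; push_cast; ring

lemma cbrt (y : ℝ) (hy : 0 ≤ y) : ∃ s : ℝ, 0 ≤ s ∧ s ^ 3 = y := by
  refine ⟨y ^ ((1 : ℝ) / 3), by positivity, ?_⟩
  rw [← Real.rpow_natCast, ← Real.rpow_mul hy]; norm_num

set_option exponentiation.threshold 1000 in
/-- J bound -/
lemma J_bound (L X s : ℝ) (J : ℕ) (hX : X = Real.exp (L / 15)) (hs : 0 < s)
    (l : ℝ) (hl : l ≤ Real.log (s ^ 3))
    (hJ : J = 0 ∨ s * X * 1.03 ^ (J - 1) ≤ X ^ 2 / 10.8) :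
    J = 0 ∨ (J : ℝ) ≤ 1 + 440 / 13 * (L / 15 - 2.375 - l / 3) := by
  rcases hJ with h | h
  · exact Or.inl h
  rcases Nat.eq_zero_or_pos J with h0 | h0
  · exact Or.inl h0
  right
  have hXp : 0 < X := by rw [hX]; exact Real.exp_pos _
  have h1 : (1.03 : ℝ) ^ (J - 1) * (10.8 * s) ≤ X := by
    have : X * ((1.03 : ℝ) ^ (J - 1) * (10.8 * s)) ≤ X * X := by
      rw [le_div_iff₀ (by norm_num)] at h
      nlinarith
    exact le_of_mul_le_mul_left this hXp
  have h2 := Real.log_le_log (by positivity) h1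
  rw [Real.log_mul (by positivity) (by positivity), Real.log_mul (by norm_num) (by positivity),
    Real.log_pow, hX, Real.log_exp, Nat.cast_sub h0] at h2
  rw [Real.log_pow] at hl
  have a1 := le_log_of 13 440 1.03 (by norm_num) (by norm_num) (by norm_num)
  have a2 := le_log_of 19 8 10.8 (by norm_num) (by norm_num) (by norm_num)
  have hJ1 : (0 : ℝ) ≤ J - 1 := by
    have : (1 : ℝ) ≤ J := by exact_mod_cast h0
    linarith
  have h3 : ((J : ℝ) - 1) * (13 / 440) ≤ ((J : ℝ) - 1) * Real.log 1.03 :=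
    mul_le_mul_of_nonneg_left (by exact_mod_cast a1) hJ1
  push_cast at h2 hl a2
  linarith

/-- final numeric contradiction, large range -/
lemma D_num (L X s h c a A sa g e : ℝ) (J : ℝ)
    (hh : h = 11 * L * X ^ 3) (ha : 98 ≤ a) (haL : a ≤ L) (hA : 600 ≤ A)
    (hX : A * (L / a) ≤ X) (hsa : 0 < sa) (hs : sa ≤ s) (hg : 0 ≤ g)
    (hJ : J ≤ g * L) (he : 0 ≤ e)
    (hnum : 0.4864 + c + 51.1047 / (11 * a) + 1.489 * g / 11 + 1.2052 / sa
      + 2.0544 * e * (g * a + 11.785) / A + 0.001 < 1)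
    (hS : h - 1 ≤ 0.456 * h + c * h + (0.0304 * h + 51.1 * X ^ 3 + 68 * X + 2
      + J * (2 + 1.48808 * X ^ 3) + 0.0047 * X ^ 3 + 1.2052 * h / s
      + 2.0544 * e * (J + 11.785) * (h / X))) : False := by
  have hLa : 1 ≤ L / a := by rw [le_div_iff₀ (by linarith)]; linarith
  have hXA : A ≤ X := by nlinarith
  have hX600 : 600 ≤ X := by linarith
  have hX3 : 0 < X ^ 3 := by positivity
  have hX3b : 360000 * X ≤ X ^ 3 := by
    have : (600:ℝ)^2 ≤ X ^ 2 := pow_le_pow_left₀ (by norm_num) hX600 2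
    have e3 : X ^ 3 = X ^ 2 * X := by ring
    rw [e3]
    nlinarith
  have hL : 0 < L := by linarith
  have hh0 : 0 < h := by rw [hh]; positivity
  have hhX : 11 * a * X ^ 3 ≤ h := by rw [hh]; gcongr
  have b1 : 51.1047 * X ^ 3 ≤ 51.1047 / (11 * a) * h := by
    rw [div_mul_eq_mul_div, le_div_iff₀ (by linarith)]
    linarith
  have b2 : 68 * X + 3 ≤ 0.001 * h := by
    have : 1078 * X ^ 3 ≤ h := le_trans (by gcongr; linarith) hhX
    linarith
  have b3 : J * (2 + 1.48808 * X ^ 3) ≤ 1.489 * g / 11 * h := by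
    calc J * (2 + 1.48808 * X ^ 3) ≤ (g * L) * (1.489 * X ^ 3) := by
          apply mul_le_mul hJ (by linarith) (by positivity) (by positivity)
      _ = 1.489 * g / 11 * h := by rw [hh]; ring
  have b4 : 1.2052 * h / s ≤ 1.2052 / sa * h := by
    rw [div_mul_eq_mul_div]
    apply div_le_div_of_nonneg_left (by positivity) hsa hs
  have b5 : 2.0544 * e * (J + 11.785) * (h / X) ≤ 2.0544 * e * (g * a + 11.785) / A * h := by
    have k : (J + 11.785) * A ≤ (g * a + 11.785) * X := by
      have k1 : J * A ≤ g * a * X := by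
        calc J * A ≤ (g * L) * A := by gcongr
          _ = g * a * (A * (L / a)) := by field_simp
          _ ≤ _ := by gcongr
      linarith
    have k2 : (J + 11.785) / X ≤ (g * a + 11.785) / A := by
      rw [div_le_div_iff₀ (by linarith) (by linarith)]; linarith
    calc 2.0544 * e * (J + 11.785) * (h / X) = 2.0544 * e * h * ((J + 11.785) / X) := by ring
      _ ≤ 2.0544 * e * h * ((g * a + 11.785) / A) := by gcongr
      _ = _ := by ring
  have := mul_lt_mul_of_pos_right hnum hh0
  linarith

/-- final numeric contradiction, middle range -/
lemma B_num (L X s h c a B sa : ℝ)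
    (hh : h = 11 * L * X ^ 3) (ha : 46 ≤ a) (haL : a ≤ L) (hX20 : 20 ≤ X)
    (hX : X ≤ B) (hsa : 0 < sa) (hs : sa ≤ s)
    (hnum : 0.4864 + c + 4.7307 * B / (sa * (11 * a)) + 0.001 < 1)
    (hS : h - 1 ≤ 0.456 * h + c * h + (0.0304 * h + 4.7307 * X ^ 4 / s + 68 * X + 2)) : False := by
  have hL : 0 < L := by linarith
  have hX3b : 400 * X ≤ X ^ 3 := by
    have : (20:ℝ)^2 ≤ X ^ 2 := pow_le_pow_left₀ (by norm_num) hX20 2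
    have e3 : X ^ 3 = X ^ 2 * X := by ring
    rw [e3]
    nlinarith
  have hh0 : 0 < h := by rw [hh]; positivity
  have b2 : 68 * X + 3 ≤ 0.001 * h := by
    have : 506 * X ^ 3 ≤ h := by rw [hh]; gcongr; linarith
    linarith
  have b1 : 4.7307 * X ^ 4 / s ≤ 4.7307 * B / (sa * (11 * a)) * h := by
    have k : 4.7307 * X ^ 4 / s ≤ 4.7307 * X ^ 4 / sa :=
      div_le_div_of_nonneg_left (by positivity) hsa hs
    have k2 : 4.7307 * B / (sa * (11 * a)) * h = 4.7307 * X ^ 3 / sa * (B * (L / a)) := by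
      rw [hh]; field_simp
    have k3 : 4.7307 * X ^ 4 / sa = 4.7307 * X ^ 3 / sa * (X * 1) := by ring
    rw [k2]
    refine k.trans ?_
    rw [k3]
    have hLa : 1 ≤ L / a := by rw [le_div_iff₀ (by linarith)]; linarith
    have hB : 0 ≤ B := by linarith
    gcongr
  have := mul_lt_mul_of_pos_right hnum hh0
  linarith

end SFI


namespace SFI
open Finset

def NoSF (x h : ℝ) : Prop := ∀ n : ℕ, x < n → (n : ℝ) ≤ x + h → ¬ Squarefree n

lemma Set0.par {L X η h : ℝ} (q : Set0 L X η h) (hL : 46 ≤ L) : Par X η := by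
  have hX21 := q.Xlow 46 21 (by norm_num) hL (by norm_num) (by
    have := le_exp_of 46 15 21 (by norm_num) (by norm_num); exact_mod_cast this)
  have e : 21 * (L / 46) = 21 / 46 * L := by ring
  rw [e] at hX21
  have h1 : 21 ≤ X := by linarith
  refine ⟨by nlinarith, by linarith, by rw [q.hη]; linarith, ?_⟩
  rw [q.hη]
  nlinarith

lemma Set0.basic {L X η h : ℝ} (q : Set0 L X η h) (hL : 36 ≤ L) :
    11 ≤ X ∧ 396 ≤ η ∧ 1331 * 396 ≤ h := by
  have hX := q.Xlow 36 11 (by norm_num) hL (by norm_num) (by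
    have := le_exp_of 36 15 11 (by norm_num) (by norm_num); exact_mod_cast this)
  have h1 : 11 ≤ X := by
    have e : 11 * (L / 36) = 11 / 36 * L := by ring
    rw [e] at hX
    linarith
  have h2 : 396 ≤ η := by rw [q.hη]; linarith
  have h3 : (11:ℝ)^3 ≤ X ^ 3 := pow_le_pow_left₀ (by norm_num) h1 3
  refine ⟨h1, h2, ?_⟩
  rw [q.hh]
  norm_num at h3
  nlinarith

/-- sieve output with threshold twice h -/
lemma Set0.siv {L X η h : ℝ} (q : Set0 L X η h) (hL : 36 ≤ L) (hno : NoSF (X ^ 15) h) :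
    ∃ S : Finset ℕ, (∀ p ∈ S, 2 * h ≤ (p : ℝ) ∧ Odd p ∧ Good (X ^ 15) h p) ∧
      h - 1 ≤ 0.456 * h + (Nat.primesLE ⌊2 * h⌋₊).card + S.card := by
  obtain ⟨h1, h2, h3⟩ := q.basic hL
  obtain ⟨S, hS, hc⟩ := sieve (X ^ 15) h (2 * h) (by positivity) (by linarith) (by linarith)
    (by nlinarith) hno
  refine ⟨S, fun p hp => ?_, hc⟩
  obtain ⟨a1, a2, a3⟩ := hS p hp
  refine ⟨a2.le, a1.odd_of_ne_two ?_, a3⟩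
  rintro rfl
  norm_num at a2
  linarith

lemma caseA {L X η h : ℝ} (q : Set0 L X η h) (a b l B c : ℝ) (ha : 36 ≤ a) (haL : a ≤ L) (hb : L ≤ b)
    (hl : l ≤ Real.log (22 * a)) (hl5 : 5 < l + a / 5)
    (hB : Real.exp (2 / 5 * b) ≤ B)
    (hc : 2.7726 / (l + a / 5 - 5) + 0.0136 ≤ c)
    (hnum : 0.456 + c + B / (5324 * a ^ 3) + 0.0001 < 1)
    (hno : NoSF (X ^ 15) h) : False := by
  have hL : 36 ≤ L := by linarith
  obtain ⟨h1, h2, h3⟩ := q.basic hL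
  obtain ⟨S, hS, hc2⟩ := q.siv hL hno
  have hh0 : 0 < h := by linarith
  have hp := pi2h5 h _ hh0 hl5 (q.log2h a l (by linarith) haL hl)
  have hp2 : ((Nat.primesLE ⌊2 * h⌋₊).card : ℝ) ≤ c * h :=
    hp.trans (mul_le_mul_of_nonneg_right hc hh0.le)
  have ht := two_pt (X ^ 15) h (2 * h) (by positivity) hh0.le (by linarith) (by linarith) S
    (fun u hu => ⟨(hS u hu).1, (hS u hu).2.2⟩)
  have hx : X ^ 15 / (2 * h) ^ 2 ≤ B / (5324 * a ^ 3) * h := by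
    have e1 : X ^ 6 ≤ B := by
      rw [q.hX, ← Real.exp_nat_mul]
      refine le_trans (Real.exp_le_exp.2 ?_) hB
      push_cast; linarith
    have e2 : 1331 * a ^ 3 ≤ η ^ 3 := by
      have : (11 * a) ^ 3 ≤ η ^ 3 := pow_le_pow_left₀ (by linarith) (by rw [q.hη]; linarith) 3
      nlinarith
    have hX0 : 0 < X := by linarith
    have ha0 : 0 < a := by linarith
    rw [div_mul_eq_mul_div, div_le_div_iff₀ (by positivity) (by positivity)]
    have e3 : B * h * (2 * h) ^ 2 = 4 * B * (η ^ 3 * X ^ 9) := by rw [q.hh]; ring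
    have e4 : X ^ 15 * (5324 * a ^ 3) = 4 * X ^ 6 * (1331 * a ^ 3 * X ^ 9) := by ring
    rw [e3, e4]
    have hB0 : 0 ≤ B := (by positivity : (0:ℝ) ≤ X ^ 6).trans e1
    gcongr
  have hy : h / (2 * h) ^ 2 ≤ 1 := by
    rw [div_le_one (by positivity)]
    nlinarith
  rw [add_div] at ht
  have := mul_lt_mul_of_pos_right hnum hh0
  linarith

lemma caseB {L X η h : ℝ} (q : Set0 L X η h) (a b l B c sa : ℝ) (ha : 46 ≤ a) (haL : a ≤ L) (hb : L ≤ b)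
    (hl : l ≤ Real.log (22 * a)) (hl5 : 6 < l + a / 5)
    (hB : Real.exp (b / 15) ≤ B)
    (hc : 2.7726 / (l + a / 5 - 6) + 0.005 ≤ c)
    (hsa : 0 < sa) (hsa3 : sa ^ 3 ≤ 22 * a)
    (hnum : 0.4864 + c + 4.7307 * B / (sa * (11 * a)) + 0.001 < 1)
    (hno : NoSF (X ^ 15) h) : False := by
  have hL : 46 ≤ L := by linarith
  obtain ⟨h1, h2, h3⟩ := q.basic (by linarith)
  obtain ⟨S, hS, hc2⟩ := q.siv (by linarith) hno
  have hh0 : 0 < h := by linarith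
  have hp := pi2h h _ hh0 hl5 (q.log2h a l (by linarith) haL hl)
  have hp2 : ((Nat.primesLE ⌊2 * h⌋₊).card : ℝ) ≤ c * h :=
    hp.trans (mul_le_mul_of_nonneg_right hc hh0.le)
  have hX20 : 20 ≤ X := by
    have hX21 := q.Xlow 46 21 (by norm_num) hL (by norm_num) (by
      have := le_exp_of 46 15 21 (by norm_num) (by norm_num); exact_mod_cast this)
    have e : 21 * (L / 46) = 21 / 46 * L := by ring
    rw [e] at hX21
    linarith
  obtain ⟨s, hs0, hs3⟩ := cbrt (22 * L) (by linarith)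
  have hss : sa ≤ s := le_of_pow_le_pow_left₀ (by norm_num : 3 ≠ 0) hs0 (by rw [hs3]; linarith)
  have hsp : 0 < s := by linarith
  have hX0 : 0 < X := by linarith
  have et : (s * X) ^ 3 = 2 * h := by rw [mul_pow, hs3, q.hh, q.hη]; ring
  have ht := tailB (q.par hL) (s * X) (by positivity) (by rw [et, q.hh]) S
    (fun u hu => by rw [et, ← q.hh]; exact hS u hu)
  rw [← q.hh] at ht
  have e5 : 4.7307 * X ^ 5 / (s * X) = 4.7307 * X ^ 4 / s := by field_simp
  rw [e5] at ht
  refine B_num L X s h c a B sa (by rw [q.hh, q.hη]) ha haL hX20 (q.Xup b B hb hB) hsa hss hnum ?_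
  linarith

lemma caseD {L X η h : ℝ} (q : Set0 L X η h) (a l c sa A g e : ℝ) (ha : 98 ≤ a) (haL : a ≤ L)
    (hl : l ≤ Real.log (22 * a)) (hl5 : 6 < l + a / 5)
    (hA : 600 ≤ A) (hAe : A ≤ Real.exp (a / 15))
    (hc : 2.7726 / (l + a / 5 - 6) + 0.005 ≤ c)
    (hsa : 0 < sa) (hsa3 : sa ^ 3 ≤ 22 * a) (hg : 0 ≤ g)
    (hgJ : 1 + 440 / 13 * (L / 15 - 2.375 - l / 3) ≤ g * L) (he : 0 ≤ e)
    (hcube : ∀ (I : Finset ℕ) (t' : ℝ), sa * X ≤ t' →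
      (∀ i ∈ I, Even i ∧ 0 < i ∧ 1.35 * t' ^ 4 / X ^ 5 ≤ (i : ℝ)) →
      ∑ i ∈ I, 1 / (i : ℝ) ^ 3 ≤ e / (1.35 * t' ^ 4 / X ^ 5) ^ 2)
    (hnum : 0.4864 + c + 51.1047 / (11 * a) + 1.489 * g / 11 + 1.2052 / sa
      + 2.0544 * e * (g * a + 11.785) / A + 0.001 < 1)
    (hno : NoSF (X ^ 15) h) : False := by
  have hL : 46 ≤ L := by linarith
  obtain ⟨h1, h2, h3⟩ := q.basic (by linarith)
  obtain ⟨S, hS, hc2⟩ := q.siv (by linarith) hno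
  have hh0 : 0 < h := by linarith
  have hp := pi2h h _ hh0 hl5 (q.log2h a l (by linarith) haL hl)
  have hp2 : ((Nat.primesLE ⌊2 * h⌋₊).card : ℝ) ≤ c * h :=
    hp.trans (mul_le_mul_of_nonneg_right hc hh0.le)
  have hXl := q.Xlow a A (by linarith) haL (by linarith) hAe
  obtain ⟨s, hs0, hs3⟩ := cbrt (22 * L) (by linarith)
  have hss : sa ≤ s := le_of_pow_le_pow_left₀ (by norm_num : 3 ≠ 0) hs0 (by rw [hs3]; linarith)
  have hsp : 0 < s := by linarith
  have hX0 : 0 < X := by linarith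
  have et : (s * X) ^ 3 = 2 * h := by rw [mul_pow, hs3, q.hh, q.hη]; ring
  have h13 : 13 * η ≤ X ^ 3 := by
    have k := q.Xlow 98 600 (by norm_num) (by linarith) (by norm_num) (by
      have := le_exp_of 98 15 600 (by norm_num) (by norm_num); exact_mod_cast this)
    have e0 : 600 * (L / 98) = 600 / 98 * L := by ring
    rw [e0] at k
    have k2 : 600 ≤ X := by linarith
    have k3 : 360000 ≤ X ^ 2 := by nlinarith
    have e1 : X ^ 3 = X ^ 2 * X := by ring
    rw [e1, q.hη]
    nlinarith
  obtain ⟨J, hJ, ht⟩ := countD (q.par hL) (s * X) (by positivity) (by rw [et, q.hh]) S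
    (fun u hu => by rw [et, ← q.hh]; exact hS u hu) h13 e he
    (fun I t' ht' hI => hcube I t' (le_trans (by gcongr) ht') hI)
  rw [← q.hh] at ht
  have hll : l ≤ Real.log (s ^ 3) := by
    rw [hs3]
    exact hl.trans (Real.log_le_log (by linarith) (by linarith))
  have hJg : (J : ℝ) ≤ g * L := by
    rcases J_bound L X s J q.hX hsp l hll hJ with k | k
    · rw [k]; push_cast; apply mul_nonneg hg; linarith
    · exact k.trans hgJ
  have e5 : 1.2052 * h * X / (s * X) = 1.2052 * h / s := by field_simp
  rw [e5] at ht
  refine D_num L X s h c a A sa g e J (by rw [q.hh, q.hη]) ha haL hA hXl hsa hss hg hJg he hnum ?_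
  linarith

lemma allD {L X η h : ℝ} (q : Set0 L X η h) (hL : 98 ≤ L) (hno : NoSF (X ^ 15) h) : False := by
  have hX0 : 0 < X := by rw [q.hX]; exact Real.exp_pos _
  have crude : ∀ sa : ℝ, 0 < sa → ∀ (I : Finset ℕ) (t' : ℝ), sa * X ≤ t' →
      (∀ i ∈ I, Even i ∧ 0 < i ∧ 1.35 * t' ^ 4 / X ^ 5 ≤ (i : ℝ)) →
      ∑ i ∈ I, 1 / (i : ℝ) ^ 3 ≤ 0.62 / (1.35 * t' ^ 4 / X ^ 5) ^ 2 := by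
    intro sa hsa I t' ht' hI
    have : 0 < t' := lt_of_lt_of_le (by positivity) ht'
    exact sum_inv_cube_crude I _ (by positivity) hI
  rcases le_total L 120 with h1 | h1
  · refine caseD q 98 7.6 0.136 12.9 687 0.89 0.3125 le_rfl hL ?_ (by norm_num) (by norm_num) ?_
      (by norm_num) (by norm_num) (by norm_num) (by norm_num) (by linarith) (by norm_num) ?_
      (by norm_num) hno
    · have := le_log_of 38 5 (22 * 98) (by norm_num) (by norm_num) (by norm_num)
      norm_num at this ⊢; exact this
    · have := le_exp_of 98 15 687 (by norm_num) (by norm_num); exact_mod_cast this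
    · intro I t' ht' hI
      refine sum_inv_cube_fine I _ ?_ hI
      have hX : X ≤ 2982 := q.Xup 120 2982 h1 (by
        have := exp_le_of 8 1 2982 (by norm_num) (by norm_num) (by norm_num)
        norm_num at this ⊢; exact this)
      have k : (12.9 * X) ^ 4 ≤ t' ^ 4 := pow_le_pow_left₀ (by positivity) ht' 4
      rw [le_div_iff₀ (by positivity)]
      have k2 : 9.5 * X ^ 5 ≤ 1.35 * (12.9 * X) ^ 4 := by
        have e1 : 9.5 * X ^ 5 = X ^ 4 * (9.5 * X) := by ring
        have e2 : 1.35 * (12.9 * X) ^ 4 = X ^ 4 * (1.35 * 12.9 ^ 4) := by ring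
        rw [e1, e2]
        apply mul_le_mul_of_nonneg_left _ (by positivity)
        norm_num at hX ⊢
        linarith
      linarith
  rcases le_total L 180 with h2 | h2
  · refine caseD q 120 7.8 0.113 13.8 2980 1.34 0.62 (by norm_num) h1 ?_ (by norm_num) (by norm_num) ?_
      (by norm_num) (by norm_num) (by norm_num) (by norm_num) (by linarith) (by norm_num)
      (crude _ (by norm_num)) (by norm_num) hno
    · have := le_log_of 39 5 (22 * 120) (by norm_num) (by norm_num) (by norm_num)
      norm_num at this ⊢; exact this
    · have := le_exp_of 8 1 2980 (by norm_num) (by norm_num)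
      norm_num at this ⊢; exact this
  · refine caseD q 180 8.25 0.08 15.8 162000 2.257 0.62 (by norm_num) h2 ?_ (by norm_num) (by norm_num) ?_
      (by norm_num) (by norm_num) (by norm_num) (by norm_num) (by linarith) (by norm_num)
      (crude _ (by norm_num)) (by norm_num) hno
    · have := le_log_of 33 4 (22 * 180) (by norm_num) (by norm_num) (by norm_num)
      norm_num at this ⊢; exact this
    · have := le_exp_of 12 1 162000 (by norm_num) (by norm_num)
      norm_num at this ⊢; exact this

lemma allB {L X η h : ℝ} (q : Set0 L X η h) (hL : 46 ≤ L) (hL2 : L ≤ 98)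
    (hno : NoSF (X ^ 15) h) : False := by
  rcases le_total L 70 with h1 | h1
  · refine caseB q 46 70 6.8 107 0.29 10 le_rfl hL h1 ?_ (by norm_num) ?_ (by norm_num)
      (by norm_num) (by norm_num) (by norm_num) hno
    · have := le_log_of 34 5 (22 * 46) (by norm_num) (by norm_num) (by norm_num)
      norm_num at this ⊢; exact this
    · have := exp_le_of 70 15 107 (by norm_num) (by norm_num) (by norm_num); exact_mod_cast this
  rcases le_total L 90 with h2 | h2
  · refine caseB q 70 90 7.2 404 0.2 11.5 (by norm_num) h1 h2 ?_ (by norm_num) ?_ (by norm_num)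
      (by norm_num) (by norm_num) (by norm_num) hno
    · have := le_log_of 36 5 (22 * 70) (by norm_num) (by norm_num) (by norm_num)
      norm_num at this ⊢; exact this
    · have := exp_le_of 90 15 404 (by norm_num) (by norm_num) (by norm_num); exact_mod_cast this
  · refine caseB q 90 98 7.4 688 0.16 12.5 (by norm_num) h2 hL2 ?_ (by norm_num) ?_ (by norm_num)
      (by norm_num) (by norm_num) (by norm_num) hno
    · have := le_log_of 37 5 (22 * 90) (by norm_num) (by norm_num) (by norm_num)
      norm_num at this ⊢; exact this
    · have := exp_le_of 98 15 688 (by norm_num) (by norm_num) (by norm_num); exact_mod_cast this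

lemma allA {L X η h : ℝ} (q : Set0 L X η h) (hL : 36 ≤ L) (hL2 : L ≤ 46)
    (hno : NoSF (X ^ 15) h) : False := by
  rcases le_total L 42 with h1 | h1
  · refine caseA q 36 42 6.6 20000000 0.34 le_rfl hL h1 ?_ (by norm_num) ?_ (by norm_num)
      (by norm_num) hno
    · have := le_log_of 33 5 (22 * 36) (by norm_num) (by norm_num) (by norm_num)
      norm_num at this ⊢; exact this
    · have := exp_le_of 84 5 20000000 (by norm_num) (by norm_num) (by norm_num)
      norm_num at this ⊢; exact this
  · refine caseA q 42 46 6.8 98000000 0.286 (by norm_num) h1 hL2 ?_ (by norm_num) ?_ (by norm_num)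
      (by norm_num) hno
    · have := le_log_of 34 5 (22 * 42) (by norm_num) (by norm_num) (by norm_num)
      norm_num at this ⊢; exact this
    · have := exp_le_of 92 5 98000000 (by norm_num) (by norm_num) (by norm_num)
      norm_num at this ⊢; exact this

end SFI


namespace SFI
open Finset

lemma exp_cube_aux (L a b B : ℝ) (ha : 0 ≤ a) (haL : a ≤ L) (hb : L ≤ b)
    (hB : Real.exp (2 / 5 * b) ≤ B) (hn : B ≤ 53.24 * a ^ 3) :
    Real.exp (2 / 5 * L) ≤ 53.24 * L ^ 3 := by
  have h1 : Real.exp (2 / 5 * L) ≤ Real.exp (2 / 5 * b) := Real.exp_le_exp.2 (by linarith)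
  have h2 : a ^ 3 ≤ L ^ 3 := pow_le_pow_left₀ ha haL 3
  linarith

lemma exp_cube (L : ℝ) (h1 : 1.94 ≤ L) (h2 : L ≤ 36) :
    Real.exp (2 / 5 * L) ≤ 53.24 * L ^ 3 := by
  rcases le_total L 14 with k1 | k1
  · refine exp_cube_aux L 1.94 14 300 (by norm_num) h1 k1 ?_ (by norm_num)
    have := exp_le_of 28 5 300 (by norm_num) (by norm_num) (by norm_num)
    norm_num at this ⊢; exact this
  rcases le_total L 28 with k2 | k2
  · refine exp_cube_aux L 14 28 80000 (by norm_num) k1 k2 ?_ (by norm_num)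
    have := exp_le_of 56 5 80000 (by norm_num) (by norm_num) (by norm_num)
    norm_num at this ⊢; exact this
  rcases le_total L 34 with k3 | k3
  · refine exp_cube_aux L 28 34 900000 (by norm_num) k2 k3 ?_ (by norm_num)
    have := exp_le_of 68 5 900000 (by norm_num) (by norm_num) (by norm_num)
    norm_num at this ⊢; exact this
  · refine exp_cube_aux L 34 36 1900000 (by norm_num) k3 h2 ?_ (by norm_num)
    have := exp_le_of 72 5 1900000 (by norm_num) (by norm_num) (by norm_num)
    norm_num at this ⊢; exact this

lemma caseS {L X η h : ℝ} (q : Set0 L X η h) (h1 : 1.94 ≤ L) (h2 : L ≤ 36)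
    (hno : NoSF (X ^ 15) h) : False := by
  have hX0 : 0 < X := by rw [q.hX]; exact Real.exp_pos _
  have hX3 : X ^ 3 = Real.exp (L / 5) := by
    rw [q.hX, ← Real.exp_nat_mul]; congr 1; push_cast; ring
  have hh : 29 ≤ h := by
    have := Real.add_one_le_exp (L / 5)
    rw [q.hh, q.hη, hX3]
    nlinarith
  obtain ⟨S, hS, hc⟩ := sieve (X ^ 15) h h (by positivity) (by linarith) (by linarith)
    (by nlinarith) hno
  have hp := pi_small h (by linarith)
  have ht := two_pt (X ^ 15) h h (by positivity) (by linarith) (by linarith) (by linarith) S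
    (fun u hu => ⟨(hS u hu).2.1.le, (hS u hu).2.2⟩)
  have hx : X ^ 15 / h ^ 2 ≤ 0.04 * h := by
    have e1 : X ^ 6 ≤ 53.24 * L ^ 3 := by
      have e0 : X ^ 6 = Real.exp (2 / 5 * L) := by
        rw [q.hX, ← Real.exp_nat_mul]; congr 1; push_cast; ring
      rw [e0]; exact exp_cube L h1 h2
    rw [div_le_iff₀ (by positivity)]
    have e3 : 0.04 * h * h ^ 2 = X ^ 9 * (53.24 * L ^ 3) := by rw [q.hh, q.hη]; ring
    have e4 : X ^ 15 = X ^ 9 * X ^ 6 := by ring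
    rw [e3, e4]
    gcongr
  have hy : h / h ^ 2 ≤ 0.1 := by
    rw [div_le_iff₀ (by positivity)]
    nlinarith
  rw [add_div] at ht
  linarith

end SFI

theorem squarefree_in_interval (x : ℝ) (hx : 2 ≤ x) :
    ∃ n : ℕ, 0 < n ∧ x < (n : ℝ) ∧ (n : ℝ) ≤ x + 11 * x ^ ((1 : ℝ) / 5) * Real.log x ∧
      Squarefree n := by
  have hx0 : 0 < x := by linarith
  rcases lt_or_ge x 7 with h7 | h7
  · refine ⟨7, by norm_num, by exact_mod_cast h7, ?_, (by norm_num : Nat.Prime 7).squarefree⟩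
    have h1 : 1 ≤ x ^ ((1 : ℝ) / 5) := Real.one_le_rpow (by linarith) (by norm_num)
    have h2 : Real.log 2 ≤ Real.log x := Real.log_le_log (by norm_num) hx
    have h3 := Real.log_two_gt_d9
    push_cast
    nlinarith
  by_contra hcon
  push Not at hcon
  obtain ⟨L, hL⟩ : ∃ L, L = Real.log x := ⟨_, rfl⟩
  have q : SFI.Set0 L (Real.exp (L / 15)) (11 * L) (11 * L * Real.exp (L / 15) ^ 3) :=
    ⟨rfl, rfl, rfl⟩
  have e1 : Real.exp (L / 15) ^ 15 = x := by rw [q.x15, hL, Real.exp_log hx0]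
  have e2 : 11 * L * Real.exp (L / 15) ^ 3 = 11 * x ^ ((1 : ℝ) / 5) * Real.log x := by
    rw [Real.rpow_def_of_pos hx0, ← hL, ← Real.exp_nat_mul]
    have : ((3 : ℕ) : ℝ) * (L / 15) = L * (1 / 5) := by push_cast; ring
    rw [this]; ring
  have hno : SFI.NoSF (Real.exp (L / 15) ^ 15) (11 * L * Real.exp (L / 15) ^ 3) := by
    intro n hn1 hn2
    rw [e1] at hn1 hn2
    rw [e2] at hn2
    refine hcon n ?_ hn1 hn2
    have : (0 : ℝ) < n := by linarith
    exact_mod_cast this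
  have hL1 : 1.94 ≤ L := by
    have k := SFI.le_log_of 97 50 7 (by norm_num) (by norm_num) (by norm_num)
    have k2 := Real.log_le_log (by norm_num) h7
    rw [hL]
    norm_num at k ⊢
    linarith
  rcases le_total L 36 with k1 | k1
  · exact SFI.caseS q hL1 k1 hno
  rcases le_total L 46 with k2 | k2
  · exact SFI.allA q k1 k2 hno
  rcases le_total L 98 with k3 | k3
  · exact SFI.allB q k2 k3 hno
  · exact SFI.allD q k3 hno
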